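/- arXiv:2304.01112 — 3 statements merged into one kernel-verified Lean document; each statement's English description precedes it below -/
import Mathlib

section
/- Define S(a) = Σ_{n=1}^∞ [ln(n/a) - a/(2n) - ψ(n/a)] for a > 0. Then for every a > 0 the functional equation S(a) = a·S(1/a) + ((ln(2π) - γ)/2)(1 - a) + ((a+1)/2)·ln a holds, where γ is the Euler–Mascheroni constant. -/
open Real

/-- The digamma function `ψ(x) = Γ'(x)/Γ(x) = d(log Γ)/dx`. -/
noncomputable def digamma (x : ℝ) : ℝ := deriv (fun y : ℝ => Real.log (Real.Gamma y)) x

/-- `S(a) = Σ_{n=1}^∞ [ln(n/a) - a/(2n) - ψ(n/a)]`. -/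
noncomputable def S (a : ℝ) : ℝ :=
  ∑' n : ℕ+, (Real.log ((n : ℝ) / a) - a / (2 * (n : ℝ)) - digamma ((n : ℝ) / a))

open Filter Topology Finset

lemma log_add_one_sub_log_le_trapezoid {y : ℝ} (hy : 0 < y) :
    Real.log (y + 1) - Real.log y ≤ (1 / y + 1 / (y + 1)) / 2 := by
  have hx : 0 < (y + 1) / y := by positivity
  have h1 : 0 ≤ Real.log ((y + 1) / y) :=
    Real.log_nonneg (by rw [le_div_iff₀ hy]; linarith)
  have h2 := Real.self_le_sinh_iff.2 h1
  rw [Real.sinh_log hx, Real.log_div (by positivity) hy.ne'] at h2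
  refine h2.trans (le_of_eq ?_)
  field_simp
  ring

lemma two_div_le_log_add_one_sub_log {y : ℝ} (hy : 0 < y) :
    2 / (2 * y + 1) ≤ Real.log (y + 1) - Real.log y := by
  have h := Real.le_log_one_add_of_nonneg (x := 1 / y) (by positivity)
  rw [show 1 + 1 / y = (y + 1) / y by field_simp, Real.log_div (by positivity) hy.ne'] at h
  refine le_trans (le_of_eq ?_) h
  field_simp
  ring

lemma trapezoid_sub_log_le {y : ℝ} (hy : 0 < y) :
    (1 / y + 1 / (y + 1)) / 2 - (Real.log (y + 1) - Real.log y)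
      ≤ 1 / (8 * y ^ 2) - 1 / (8 * (y + 1) ^ 2) := by
  have h := two_div_le_log_add_one_sub_log hy
  have key : (1 / y + 1 / (y + 1)) / 2 - 2 / (2 * y + 1)
      ≤ 1 / (8 * y ^ 2) - 1 / (8 * (y + 1) ^ 2) := by
    rw [← sub_nonneg]
    have : 1 / (8 * y ^ 2) - 1 / (8 * (y + 1) ^ 2)
        - ((1 / y + 1 / (y + 1)) / 2 - 2 / (2 * y + 1))
        = 1 / (8 * y ^ 2 * (y + 1) ^ 2 * (2 * y + 1)) := by
      field_simp
      ring
    rw [this]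
    positivity
  linarith

lemma differentiableAt_log_Gamma {x : ℝ} (hx : 0 < x) :
    DifferentiableAt ℝ (fun y : ℝ => Real.log (Real.Gamma y)) x :=
  (Real.differentiableAt_Gamma fun m => by
    have : (0 : ℝ) ≤ m := m.cast_nonneg
    linarith).log (Real.Gamma_pos_of_pos hx).ne'

lemma log_Gamma_add_one {x : ℝ} (hx : 0 < x) :
    Real.log (Real.Gamma (x + 1)) = Real.log x + Real.log (Real.Gamma x) := by
  rw [Real.Gamma_add_one hx.ne', Real.log_mul hx.ne' (Real.Gamma_pos_of_pos hx).ne']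

lemma digamma_add_one {x : ℝ} (hx : 0 < x) : digamma (x + 1) = digamma x + 1 / x := by
  unfold digamma
  rw [← deriv_comp_add_const]
  have h : (fun y : ℝ => Real.log (Real.Gamma (y + 1)))
      =ᶠ[𝓝 x] fun y => Real.log y + Real.log (Real.Gamma y) := by
    filter_upwards [lt_mem_nhds hx] with y hy using log_Gamma_add_one hy
  rw [h.deriv_eq, deriv_fun_add (Real.differentiableAt_log hx.ne') (differentiableAt_log_Gamma hx),
    Real.deriv_log]
  ring

lemma slope_log_Gamma {x : ℝ} (hx : 0 < x) :
    slope (fun y : ℝ => Real.log (Real.Gamma y)) x (x + 1) = Real.log x := by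
  rw [slope_def_field, log_Gamma_add_one hx]
  ring

lemma digamma_le_log {x : ℝ} (hx : 0 < x) : digamma x ≤ Real.log x := by
  rw [← slope_log_Gamma hx]
  exact Real.convexOn_log_Gamma.deriv_le_slope (Set.mem_Ioi.2 hx) (Set.mem_Ioi.2 (by linarith))
    (by linarith) (differentiableAt_log_Gamma hx)

lemma log_sub_inv_le_digamma {x : ℝ} (hx : 0 < x) : Real.log x - 1 / x ≤ digamma x := by
  have h : Real.log x ≤ digamma (x + 1) := by
    rw [← slope_log_Gamma hx]
    exact Real.convexOn_log_Gamma.slope_le_deriv (Set.mem_Ioi.2 hx) (Set.mem_Ioi.2 (by linarith))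
      (by linarith) (differentiableAt_log_Gamma (by linarith))
  rw [digamma_add_one hx] at h
  linarith

/-- The remainder `ln x - 1/(2x) - ψ(x)` in the asymptotic expansion of the digamma function. -/
noncomputable def digammaRem (x : ℝ) : ℝ := Real.log x - 1 / (2 * x) - digamma x

lemma digammaRem_eq_add_one {x : ℝ} (hx : 0 < x) :
    digammaRem x = digammaRem (x + 1)
      + ((1 / x + 1 / (x + 1)) / 2 - (Real.log (x + 1) - Real.log x)) := by
  unfold digammaRem
  rw [digamma_add_one hx]
  field_simp
  ring

lemma tendsto_one_div_add_nat (x : ℝ) : Tendsto (fun n : ℕ => 1 / (x + n)) atTop (𝓝 0) :=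
  tendsto_const_nhds.div_atTop
    (tendsto_atTop_add_const_left _ _ tendsto_natCast_atTop_atTop)

lemma abs_digammaRem_le_inv {x : ℝ} (hx : 0 < x) : |digammaRem x| ≤ 1 / x := by
  have h1 := digamma_le_log hx
  have h2 := log_sub_inv_le_digamma hx
  have h3 : 1 / (2 * x) = 1 / x / 2 := by field_simp
  have h4 : 0 < 1 / x := by positivity
  unfold digammaRem
  rw [abs_le]
  constructor <;> linarith

lemma tendsto_digammaRem_add_nat {x : ℝ} (hx : 0 < x) :
    Tendsto (fun n : ℕ => digammaRem (x + n)) atTop (𝓝 0) :=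
  squeeze_zero_norm (fun n => abs_digammaRem_le_inv (by positivity)) (tendsto_one_div_add_nat x)

lemma digammaRem_nonneg {x : ℝ} (hx : 0 < x) : 0 ≤ digammaRem x := by
  have hanti : Antitone fun n : ℕ => digammaRem (x + n) := antitone_nat_of_succ_le fun n => by
    have hn : 0 < x + n := by positivity
    have h1 := digammaRem_eq_add_one hn
    have h2 := log_add_one_sub_log_le_trapezoid hn
    push_cast
    rw [← add_assoc]
    linarith
  simpa using hanti.le_of_tendsto (tendsto_digammaRem_add_nat hx) 0

lemma digammaRem_le {x : ℝ} (hx : 0 < x) : digammaRem x ≤ 1 / (8 * x ^ 2) := by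
  have hmono : Monotone fun n : ℕ => digammaRem (x + n) - 1 / (8 * (x + n) ^ 2) :=
    monotone_nat_of_le_succ fun n => by
      have hn : 0 < x + n := by positivity
      have h1 := digammaRem_eq_add_one hn
      have h2 := trapezoid_sub_log_le hn
      push_cast
      rw [← add_assoc]
      linarith
  have hlim : Tendsto (fun n : ℕ => digammaRem (x + n) - 1 / (8 * (x + n) ^ 2)) atTop (𝓝 0) := by
    have h := (tendsto_digammaRem_add_nat hx).sub
      (((tendsto_one_div_add_nat x).pow 2).const_mul (1 / 8))
    have h0 : (0 : ℝ) - 1 / 8 * 0 ^ 2 = 0 := by norm_num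
    rw [h0] at h
    refine h.congr fun n => ?_
    have hn : 0 < x + n := by positivity
    field_simp
  have := hmono.ge_of_tendsto hlim 0
  simp only [Nat.cast_zero, add_zero] at this
  linarith

lemma digammaRem_eq_add_nat {x : ℝ} (hx : 0 < x) (M : ℕ) :
    digammaRem x = Real.log x + 1 / (2 * x) - Real.log (x + M) - 1 / (2 * (x + M))
      + digammaRem (x + M) + ∑ k ∈ range M, 1 / (x + (k + 1)) := by
  induction M with
  | zero => simp
  | succ M ih =>
    have hM : 0 < x + M := by positivity
    rw [ih, digammaRem_eq_add_one hM, sum_range_succ]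
    push_cast
    rw [← add_assoc]
    field_simp
    ring_nf

lemma hasSum_S {a : ℝ} (ha : 0 < a) :
    HasSum (fun i : ℕ => digammaRem (((i : ℝ) + 1) / a)) (S a) := by
  have hsum : Summable fun i : ℕ => digammaRem (((i : ℝ) + 1) / a) := by
    have hs : Summable fun i : ℕ => a ^ 2 / 8 * (1 / (((i + 1 : ℕ) : ℝ)) ^ 2) :=
      (((summable_nat_add_iff 1).2 (Real.summable_one_div_nat_pow.2 one_lt_two))).mul_left _
    refine Summable.of_nonneg_of_le (fun i => digammaRem_nonneg (by positivity))
      (fun i => (digammaRem_le (by positivity)).trans (le_of_eq ?_)) hs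
    push_cast
    field_simp
  have hS : S a = ∑' i : ℕ, digammaRem (((i : ℝ) + 1) / a) := by
    unfold S
    have h := tsum_pnat_eq_tsum_succ (f := fun n : ℕ =>
      Real.log ((n : ℝ) / a) - a / (2 * (n : ℝ)) - digamma ((n : ℝ) / a))
    rw [h]
    refine tsum_congr fun i => ?_
    unfold digammaRem
    push_cast
    congr 2
    field_simp
  rw [hS]
  exact hsum.hasSum

/-- A sum over `n` points far out equals the increment of an approximate antidifference, up to
`o(1)`. -/
lemma tendsto_sum_sub_increment {F f : ℝ → ℝ}
    (hF : ∀ y, 0 < y → |f (y + 1) - (F (y + 1) - F y)| ≤ 1 / y ^ 2) {c : ℝ} (hc : 0 < c) :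
    Tendsto (fun N : ℕ => ∑ i ∈ range N, f ((i : ℝ) + 1 + c * N)
      - (F ((1 + c) * N) - F (c * N))) atTop (𝓝 0) := by
  have hlim : Tendsto (fun N : ℕ => 1 / c ^ 2 * (1 / (N : ℝ))) atTop (𝓝 0) := by
    simpa only [mul_zero] using
      (tendsto_one_div_atTop_nhds_zero_nat (𝕜 := ℝ)).const_mul (1 / c ^ 2)
  refine squeeze_zero_norm' ?_ hlim
  filter_upwards [eventually_gt_atTop 0] with N hN
  have hN' : (0 : ℝ) < N := by exact_mod_cast hN
  have htel := sum_range_sub (fun i : ℕ => F ((i : ℝ) + c * N)) N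
  rw [Nat.cast_zero, zero_add, show (N : ℝ) + c * N = (1 + c) * N by ring] at htel
  rw [← htel, ← sum_sub_distrib]
  calc _ ≤ ∑ i ∈ range N, 1 / (c * (N : ℝ)) ^ 2 := by
        refine norm_sum_le_of_le _ fun i _ => ?_
        have hy : 0 < (i : ℝ) + c * N := by positivity
        have h := hF _ hy
        push_cast
        rw [show (i : ℝ) + 1 + c * N = i + c * N + 1 by ring, Real.norm_eq_abs]
        refine h.trans ?_
        gcongr
        linarith [Nat.cast_nonneg (α := ℝ) i]
    _ = 1 / c ^ 2 * (1 / (N : ℝ)) := by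
        rw [sum_const, card_range, nsmul_eq_mul]
        field_simp

lemma tendsto_sum_inv_shift {c : ℝ} (hc : 0 < c) :
    Tendsto (fun N : ℕ => ∑ i ∈ range N, 1 / ((i : ℝ) + 1 + c * N)) atTop
      (𝓝 (Real.log (1 + c) - Real.log c)) := by
  have h := tendsto_sum_sub_increment (F := Real.log) (f := fun y => 1 / y) (fun y hy => by
    have h1 := log_add_one_sub_log_le_trapezoid hy
    have h2 := two_div_le_log_add_one_sub_log hy
    have h3 : 1 / (y + 1) ≤ 2 / (2 * y + 1) := by
      rw [div_le_div_iff₀ (by positivity) (by positivity)]; linarith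
    have h4 : 1 / y - 1 / (y + 1) ≤ 1 / y ^ 2 := by
      rw [div_sub_div _ _ (by positivity) (by positivity),
        div_le_div_iff₀ (by positivity) (by positivity)]
      nlinarith
    have h5 : 0 ≤ 1 / y ^ 2 := by positivity
    rw [abs_le]
    constructor <;> linarith) hc
  have h' := h.add_const (Real.log (1 + c) - Real.log c)
  rw [zero_add] at h'
  refine h'.congr' ?_
  filter_upwards [eventually_gt_atTop 0] with N hN
  have hN' : (0 : ℝ) < N := by exact_mod_cast hN
  rw [Real.log_mul (by positivity) hN'.ne', Real.log_mul hc.ne' hN'.ne']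
  ring

lemma tendsto_sum_log_shift {c : ℝ} (hc : 0 < c) :
    Tendsto (fun N : ℕ => ∑ i ∈ range N, Real.log ((i : ℝ) + 1 + c * N)
      - (N * Real.log N + N * ((1 + c) * Real.log (1 + c) - c * Real.log c - 1))) atTop
      (𝓝 ((Real.log (1 + c) - Real.log c) / 2)) := by
  have h := tendsto_sum_sub_increment (F := fun y => y * Real.log y - y + Real.log y / 2)
    (f := Real.log) (fun y hy => by
    have h1 := mul_le_mul_of_nonneg_left (log_add_one_sub_log_le_trapezoid hy)
      (by positivity : 0 ≤ y + 1 / 2)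
    have h2 := mul_le_mul_of_nonneg_left (two_div_le_log_add_one_sub_log hy)
      (by positivity : 0 ≤ y + 1 / 2)
    have h3 : (y + 1 / 2) * (2 / (2 * y + 1)) = 1 := by field_simp
    have h4 : (y + 1 / 2) * ((1 / y + 1 / (y + 1)) / 2) = 1 + 1 / (4 * y * (y + 1)) := by
      field_simp; ring
    have h5 : 1 / (4 * y * (y + 1)) ≤ 1 / y ^ 2 := by
      gcongr
      nlinarith
    rw [h3] at h2
    rw [h4] at h1
    have h6 : 0 ≤ 1 / y ^ 2 := by positivity
    rw [abs_le]
    constructor <;> nlinarith) hc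
  have h' := h.add_const ((Real.log (1 + c) - Real.log c) / 2)
  rw [zero_add] at h'
  refine h'.congr' ?_
  filter_upwards [eventually_gt_atTop 0] with N hN
  have hN' : (0 : ℝ) < N := by exact_mod_cast hN
  rw [Real.log_mul (by positivity) hN'.ne', Real.log_mul hc.ne' hN'.ne']
  ring

lemma tendsto_log_factorial_sub :
    Tendsto (fun N : ℕ => Real.log (N.factorial : ℝ)
      - (N * Real.log N - N + Real.log N / 2)) atTop (𝓝 (Real.log (2 * π) / 2)) := by
  have h := (Stirling.tendsto_stirlingSeq_sqrt_pi.log (by positivity)).add_const (Real.log 2 / 2)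
  have hlim : Real.log √π + Real.log 2 / 2 = Real.log (2 * π) / 2 := by
    rw [Real.log_sqrt Real.pi_pos.le, Real.log_mul two_ne_zero Real.pi_ne_zero]
    ring
  rw [hlim] at h
  refine h.congr' ?_
  filter_upwards [eventually_gt_atTop 0] with N hN
  have hN' : (0 : ℝ) < N := by exact_mod_cast hN
  rw [Stirling.log_stirlingSeq_formula, Real.log_mul two_ne_zero hN'.ne',
    Real.log_div hN'.ne' (Real.exp_pos 1).ne', Real.log_exp]
  ring

/-- The part of the `N`-th partial sum of `S a` that is left after removing the symmetric double
sum and the remainders. -/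
noncomputable def elementaryPart (a : ℝ) (N : ℕ) : ℝ :=
  Real.log (N.factorial : ℝ) + a / 2 * (harmonic N : ℝ)
    - ∑ i ∈ range N, Real.log ((i : ℝ) + 1 + a * N)
    - a / 2 * ∑ i ∈ range N, 1 / ((i : ℝ) + 1 + a * N)

lemma tendsto_elementaryPart {a : ℝ} (ha : 0 < a) :
    Tendsto (fun N : ℕ => elementaryPart a N
      - ((1 + a) / 2 * Real.log N - N * ((1 + a) * Real.log (1 + a) - a * Real.log a))) atTop
      (𝓝 (Real.log (2 * π) / 2 + a / 2 * Real.eulerMascheroniConstant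
        - (Real.log (1 + a) - Real.log a) / 2
        - a / 2 * (Real.log (1 + a) - Real.log a))) := by
  refine (((tendsto_log_factorial_sub.add (Real.tendsto_harmonic_sub_log.const_mul (a / 2))).sub
    (tendsto_sum_log_shift ha)).sub ((tendsto_sum_inv_shift ha).const_mul (a / 2))).congr
    fun N => ?_
  unfold elementaryPart
  ring

lemma log_factorial_eq_sum (N : ℕ) :
    Real.log (N.factorial : ℝ) = ∑ i ∈ range N, Real.log ((i : ℝ) + 1) := by
  rw [← prod_range_add_one_eq_factorial, Nat.cast_prod,
    Real.log_prod fun i _ => by positivity]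
  push_cast
  rfl

lemma sum_digammaRem {a : ℝ} (ha : 0 < a) (N : ℕ) :
    ∑ i ∈ range N, digammaRem (((i : ℝ) + 1) / a)
      = elementaryPart a N + ∑ i ∈ range N, digammaRem (((i : ℝ) + 1) / a + N)
        + ∑ i ∈ range N, ∑ k ∈ range N, 1 / (((i : ℝ) + 1) / a + (k + 1)) := by
  unfold elementaryPart
  rw [log_factorial_eq_sum, harmonic]
  push_cast
  simp only [mul_sum, ← sum_add_distrib, ← sum_sub_distrib]
  refine sum_congr rfl fun i _ => ?_
  rw [digammaRem_eq_add_nat (by positivity) N]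
  have hi : (0 : ℝ) < (i : ℝ) + 1 := by positivity
  have hiN : (0 : ℝ) < (i : ℝ) + 1 + a * N := by positivity
  have h1 : ((i : ℝ) + 1) / a + N = ((i : ℝ) + 1 + a * N) / a := by field_simp
  rw [h1, Real.log_div hi.ne' ha.ne', Real.log_div hiN.ne' ha.ne']
  have h2 : 1 / (2 * (((i : ℝ) + 1) / a)) = a / 2 * ((i : ℝ) + 1)⁻¹ := by field_simp
  have h3 : 1 / (2 * (((i : ℝ) + 1 + a * N) / a)) = a / 2 * (1 / ((i : ℝ) + 1 + a * N)) := by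
    field_simp
  rw [h2, h3]
  ring

lemma tendsto_sum_digammaRem_shift {a : ℝ} (ha : 0 < a) :
    Tendsto (fun N : ℕ => ∑ i ∈ range N, digammaRem (((i : ℝ) + 1) / a + N)) atTop (𝓝 0) := by
  refine squeeze_zero' (Eventually.of_forall fun N =>
    sum_nonneg fun i _ => digammaRem_nonneg (by positivity)) ?_
    (tendsto_one_div_atTop_nhds_zero_nat (𝕜 := ℝ))
  filter_upwards [eventually_gt_atTop 0] with N hN
  have hN' : (0 : ℝ) < N := by exact_mod_cast hN
  calc _ ≤ ∑ i ∈ range N, 1 / (N : ℝ) ^ 2 := by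
        refine sum_le_sum fun i _ => (digammaRem_le (by positivity)).trans ?_
        have hi : 0 < ((i : ℝ) + 1) / a := by positivity
        gcongr
        nlinarith
    _ = 1 / (N : ℝ) := by
        rw [sum_const, card_range, nsmul_eq_mul]
        field_simp

lemma double_sum_symm {a : ℝ} (ha : 0 < a) (N : ℕ) :
    ∑ i ∈ range N, ∑ k ∈ range N, 1 / (((i : ℝ) + 1) / a + (k + 1))
      = a * ∑ i ∈ range N, ∑ k ∈ range N, 1 / (((i : ℝ) + 1) / (1 / a) + (k + 1)) := by
  rw [sum_comm]
  simp only [mul_sum]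
  refine sum_congr rfl fun k _ => sum_congr rfl fun i _ => ?_
  field_simp
  ring

theorem S_functional_equation (a : ℝ) (ha : 0 < a) :
    S a = a * S (1 / a)
      + (Real.log (2 * π) - Real.eulerMascheroniConstant) / 2 * (1 - a)
      + (a + 1) / 2 * Real.log a := by
  have ha' : 0 < 1 / a := by positivity
  have hL := (hasSum_S ha).tendsto_sum_nat.sub ((hasSum_S ha').tendsto_sum_nat.const_mul a)
  have hlog : Real.log (1 + 1 / a) = Real.log (1 + a) - Real.log a := by
    rw [← Real.log_div (by positivity) ha.ne']
    congr 1
    field_simp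
    ring
  have hloginv : Real.log (1 / a) = -Real.log a := by rw [one_div, Real.log_inv]
  have hR := ((tendsto_elementaryPart ha).add (tendsto_sum_digammaRem_shift ha)).sub
    (((tendsto_elementaryPart ha').add (tendsto_sum_digammaRem_shift ha')).const_mul a)
  have heq := tendsto_nhds_unique hL (hR.congr fun N => by
    rw [sum_digammaRem ha, sum_digammaRem ha', double_sum_symm ha, hlog, hloginv]
    field_simp
    ring)
  rw [hlog, hloginv] at heq
  rw [sub_eq_iff_eq_add.1 heq]
  field_simp
  ring
end

section
/- For 0 < Re z < 1, lim_{w → 0⁺} [(1/Γ(z)) ∫_0^∞ t^{z-1}/(e^t - 1 + w) dt - Γ(1-z)·w^{z-1}] = ζ(z), where ζ is the Riemann zeta function. -/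
open Real Complex Filter MeasureTheory

open scoped Topology

open Set Asymptotics

lemma abs_inv_exp_sub_one_sub_inv_le {t : ℝ} (ht : 0 < t) :
    |1 / (Real.exp t - 1) - 1 / t| ≤ 1 := by
  have h1 : t < Real.exp t - 1 := by linarith [Real.add_one_lt_exp ht.ne']
  have h2 : 1 / (Real.exp t - 1) ≤ 1 / t := one_div_le_one_div_of_le ht h1.le
  have h3 : (1 - t) * Real.exp t ≤ 1 := by
    have := mul_le_mul_of_nonneg_right (Real.one_sub_le_exp_neg t) (Real.exp_pos t).le
    rwa [← Real.exp_add, neg_add_cancel, Real.exp_zero] at this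
  rw [abs_le]
  constructor
  · have h4 : 1 / t - 1 / (Real.exp t - 1) ≤ 1 := by
      rw [div_sub_div _ _ ht.ne' (by linarith), div_le_one (by nlinarith)]
      nlinarith
    linarith
  · linarith

lemma exp_ofReal_sub_one_ne_zero {t : ℝ} (ht : 0 < t) : Complex.exp t - 1 ≠ 0 := by
  have : Real.exp t - 1 ≠ 0 := by linarith [Real.add_one_lt_exp ht.ne']
  exact_mod_cast this

lemma continuousOn_inv_exp_sub_one :
    ContinuousOn (fun t : ℝ ↦ 1 / (Complex.exp t - 1)) (Ioi 0) :=
  ContinuousOn.div continuousOn_const (by fun_prop) fun _ ht ↦ exp_ofReal_sub_one_ne_zero ht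

lemma continuousOn_one_div_ofReal : ContinuousOn (fun t : ℝ ↦ 1 / (t : ℂ)) (Ioi 0) :=
  ContinuousOn.div continuousOn_const (by fun_prop) fun _ ht ↦ by
    simpa using (ne_of_gt ht)

lemma norm_inv_exp_sub_one_sub_inv_le {t : ℝ} (ht : 0 < t) :
    ‖1 / (Complex.exp t - 1) - 1 / (t : ℂ)‖ ≤ 1 := by
  have := abs_inv_exp_sub_one_sub_inv_le ht
  rw [← Real.norm_eq_abs, ← Complex.norm_real] at this
  exact_mod_cast this

lemma isBigO_inv_exp_sub_one_atTop :
    (fun t : ℝ ↦ 1 / (Complex.exp t - 1)) =O[atTop] fun t ↦ Real.exp (-1 * t) := by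
  refine IsBigO.of_bound 2 ?_
  filter_upwards [eventually_ge_atTop 1] with t ht
  have h1 : 2 ≤ Real.exp t := by linarith [Real.add_one_le_exp t]
  have h2 : ‖1 / (Complex.exp t - 1)‖ = 1 / (Real.exp t - 1) := by
    have : (1 / (Complex.exp t - 1) : ℂ) = ((1 / (Real.exp t - 1) : ℝ) : ℂ) := by push_cast; rfl
    rw [this, Complex.norm_real, Real.norm_of_nonneg (one_div_nonneg.2 (by linarith))]
  rw [h2, Real.norm_of_nonneg (Real.exp_pos _).le, neg_one_mul, Real.exp_neg, ← div_eq_mul_inv,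
    div_le_div_iff₀ (by linarith) (by linarith)]
  linarith

lemma isBigO_inv_exp_sub_one_sub_inv_zero :
    (fun t : ℝ ↦ 1 / (Complex.exp t - 1) - 1 / (t : ℂ)) =O[𝓝[>] 0] fun t ↦ t ^ (-0 : ℝ) := by
  refine IsBigO.of_bound 1 ?_
  filter_upwards [self_mem_nhdsWithin] with t ht
  simpa using norm_inv_exp_sub_one_sub_inv_le ht

lemma mellinConvergent_inv_exp_sub_one {s : ℂ} (hs : 1 < s.re) :
    MellinConvergent (fun t : ℝ ↦ 1 / (Complex.exp t - 1)) s := by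
  refine mellinConvergent_of_isBigO_rpow_exp one_pos
    (continuousOn_inv_exp_sub_one.locallyIntegrableOn measurableSet_Ioi)
    isBigO_inv_exp_sub_one_atTop (b := 1) ?_ hs
  refine IsBigO.of_bound 1 ?_
  filter_upwards [self_mem_nhdsWithin] with t ht
  have ht : 0 < t := ht
  have h1 : t ≤ Real.exp t - 1 := by linarith [Real.add_one_le_exp t]
  have h2 : (1 / (Complex.exp t - 1) : ℂ) = ((1 / (Real.exp t - 1) : ℝ) : ℂ) := by push_cast; rfl
  rw [h2, Complex.norm_real, Real.norm_of_nonneg (one_div_nonneg.2 (by linarith)),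
    Real.rpow_neg_one, Real.norm_of_nonneg (by positivity), one_mul, ← one_div]
  exact one_div_le_one_div_of_le ht h1

lemma mellin_inv_exp_sub_one {s : ℂ} (hs : 1 < s.re) :
    mellin (fun t : ℝ ↦ 1 / (Complex.exp t - 1)) s = Complex.Gamma s * riemannZeta s := by
  have key := hasSum_mellin (ι := ℕ) (a := fun _ ↦ 1) (p := fun n ↦ (n : ℝ) + 1)
    (F := fun t : ℝ ↦ 1 / (Complex.exp t - 1)) (s := s) (fun n ↦ Or.inr (by positivity))
    (by linarith) ?_ ?_
  · rw [← key.tsum_eq, zeta_eq_tsum_one_div_nat_add_one_cpow hs, ← tsum_mul_left]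
    refine tsum_congr fun n ↦ ?_
    push_cast
    ring
  · intro t ht
    have ht : 0 < t := ht
    have hlt : ‖Complex.exp (-t)‖ < 1 := by
      rw [← Complex.ofReal_neg, Complex.norm_exp_ofReal]
      exact Real.exp_lt_one_iff.2 (by linarith)
    convert! (hasSum_geometric_of_norm_lt_one hlt).mul_left (Complex.exp (-t)) using 1
    · ext1 n
      rw [← Complex.exp_nat_mul, ← Complex.exp_add]
      push_cast
      rw [one_mul]
      congr 1
      ring
    · have h1 := exp_ofReal_sub_one_ne_zero ht
      have h2 : Complex.exp t ≠ 0 := Complex.exp_ne_zero _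
      rw [Complex.exp_neg]
      field_simp
  · have := Real.summable_one_div_nat_rpow.2 hs
    have := (summable_nat_add_iff 1).2 this
    simpa using this

/-- `1 / (e ^ t - 1)` with its pole at `0` removed on `(0, 1]`. -/
noncomputable def invExpSubOneReg (t : ℝ) : ℂ :=
  1 / (Complex.exp t - 1) - (Ioc (0 : ℝ) 1).indicator (fun t ↦ (t : ℂ) ^ (-1 : ℂ)) t

lemma locallyIntegrableOn_invExpSubOneReg : LocallyIntegrableOn invExpSubOneReg (Ioi 0) := by
  refine (continuousOn_inv_exp_sub_one.locallyIntegrableOn measurableSet_Ioi).sub ?_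
  have h : LocallyIntegrableOn (fun t : ℝ ↦ (t : ℂ) ^ (-1 : ℂ)) (Ioi 0) := by
    simp_rw [Complex.cpow_neg_one, ← one_div]
    exact continuousOn_one_div_ofReal.locallyIntegrableOn measurableSet_Ioi
  intro x hx
  obtain ⟨u, hu, hu'⟩ := h x hx
  exact ⟨u, hu, hu'.indicator measurableSet_Ioc⟩

lemma differentiableAt_mellin_invExpSubOneReg {s : ℂ} (hs : 0 < s.re) :
    MellinConvergent invExpSubOneReg s ∧ DifferentiableAt ℂ (mellin invExpSubOneReg) s := by
  have htop : invExpSubOneReg =O[atTop] fun t ↦ Real.exp (-1 * t) := by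
    refine isBigO_inv_exp_sub_one_atTop.congr' ?_ EventuallyEq.rfl
    filter_upwards [eventually_gt_atTop 1] with t ht
    simp [invExpSubOneReg, ht]
  have hbot : invExpSubOneReg =O[𝓝[>] 0] fun t ↦ t ^ (-0 : ℝ) := by
    refine isBigO_inv_exp_sub_one_sub_inv_zero.congr' ?_ EventuallyEq.rfl
    filter_upwards [Ioc_mem_nhdsGT one_pos] with t ht
    rw [invExpSubOneReg, indicator_of_mem ht, Complex.cpow_neg_one, one_div (t : ℂ)]
  exact ⟨mellinConvergent_of_isBigO_rpow_exp one_pos locallyIntegrableOn_invExpSubOneReg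
      htop hbot hs,
    mellin_differentiableAt_of_isBigO_rpow_exp one_pos locallyIntegrableOn_invExpSubOneReg
      htop hbot hs⟩

lemma mellin_invExpSubOneReg_of_one_lt_re {s : ℂ} (hs : 1 < s.re) :
    mellin invExpSubOneReg s = Complex.Gamma s * riemannZeta s - 1 / (s - 1) := by
  have h := hasMellin_cpow_Ioc (-1) (s := s) (by simpa using hs)
  have := hasMellin_sub (mellinConvergent_inv_exp_sub_one hs) h.1
  rw [mellin_inv_exp_sub_one hs, h.2, ← sub_eq_add_neg] at this
  exact this.2

lemma mellin_invExpSubOneReg {s : ℂ} (hs : 0 < s.re) (hs1 : s ≠ 1) :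
    mellin invExpSubOneReg s = Complex.Gamma s * riemannZeta s - 1 / (s - 1) := by
  set U : Set ℂ := {s | 0 < s.re} with hU
  have hUo : IsOpen U := isOpen_lt continuous_const Complex.continuous_re
  have hUc : IsPreconnected U := (convex_halfSpace_re_gt 0).isPreconnected
  have hΓ : ∀ s ∈ U, DifferentiableAt ℂ Complex.Gamma s := fun s hs ↦
    Complex.differentiableAt_Gamma s fun m h ↦ by
      have : 0 < s.re := hs
      rw [h] at this
      simp at this
      linarith [(Nat.cast_nonneg m : (0 : ℝ) ≤ m)]
  set Z : ℂ → ℂ := Function.update (fun s ↦ (s - 1) * riemannZeta s) 1 1 with hZ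
  have hZd : Differentiable ℂ Z := by
    rw [← differentiableOn_univ,
      ← Complex.differentiableOn_compl_singleton_and_continuousAt_iff (c := 1) univ_mem]
    constructor
    · intro s hs
      have hs : s ≠ 1 := by simpa using hs
      have : DifferentiableAt ℂ (fun s ↦ (s - 1) * riemannZeta s) s :=
        (by fun_prop : DifferentiableAt ℂ (fun s : ℂ ↦ s - 1) s).mul
          (differentiableAt_riemannZeta hs)
      refine (this.congr_of_eventuallyEq ?_).differentiableWithinAt
      filter_upwards [isOpen_ne.mem_nhds hs] with x hx
      exact Function.update_of_ne hx _ _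
    · exact continuousAt_update_same.2 riemannZeta_residue_one
  have hL : AnalyticOnNhd ℂ (fun s ↦ (s - 1) * mellin invExpSubOneReg s) U :=
    DifferentiableOn.analyticOnNhd (fun s hs ↦
      ((by fun_prop : DifferentiableAt ℂ (fun s : ℂ ↦ s - 1) s).mul
        (differentiableAt_mellin_invExpSubOneReg hs).2).differentiableWithinAt) hUo
  have hR : AnalyticOnNhd ℂ (fun s ↦ Complex.Gamma s * Z s - 1) U :=
    DifferentiableOn.analyticOnNhd (fun s hs ↦
      (((hΓ s hs).mul (hZd s)).sub_const 1).differentiableWithinAt) hUo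
  have heq := hL.eqOn_of_preconnected_of_eventuallyEq hR hUc
    (show (2 : ℂ) ∈ U by simp [hU]) ?_ hs
  · simp only [hZ, Function.update_of_ne hs1] at heq
    have h1 : s - 1 ≠ 0 := sub_ne_zero.2 hs1
    field_simp
    linear_combination heq
  · filter_upwards [(isOpen_lt continuous_const Complex.continuous_re).mem_nhds
      (show (1 : ℝ) < (2 : ℂ).re by simp)] with x hx
    have hx : 1 < x.re := hx
    have hx1 : x ≠ 1 := by rintro rfl; simp at hx
    have h1 : x - 1 ≠ 0 := sub_ne_zero.2 hx1
    simp only [hZ, Function.update_of_ne hx1, mellin_invExpSubOneReg_of_one_lt_re hx]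
    field_simp

/-- In the critical strip, `Γ(s) ζ(s)` is the Mellin transform of `1 / (e ^ t - 1) - 1 / t`. -/
lemma hasMellin_inv_exp_sub_one_sub_inv {s : ℂ} (hs0 : 0 < s.re) (hs1 : s.re < 1) :
    HasMellin (fun t : ℝ ↦ 1 / (Complex.exp t - 1) - 1 / (t : ℂ)) s
      (Complex.Gamma s * riemannZeta s) := by
  have hs : s ≠ 1 := by rintro rfl; simp at hs1
  have hre : (s - 2).re < -1 := by simp; linarith
  have hsm : ∀ t : ℝ, 0 < t → (t : ℂ) ^ (s - 1) * (t : ℂ)⁻¹ = (t : ℂ) ^ (s - 2) := fun t ht ↦ by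
    rw [← Complex.cpow_neg_one, ← Complex.cpow_add _ _ (by simpa using ht.ne')]
    congr 1
    ring
  have hfun : ∀ t : ℝ, (t : ℂ) ^ (s - 1) • (Ioi (1 : ℝ)).indicator (fun t ↦ (t : ℂ)⁻¹) t =
      (Ioi (1 : ℝ)).indicator (fun t : ℝ ↦ (t : ℂ) ^ (s - 2)) t := fun t ↦ by
    by_cases ht : t ∈ Ioi (1 : ℝ)
    · rw [indicator_of_mem ht, indicator_of_mem ht, smul_eq_mul, hsm t (one_pos.trans ht)]
    · simp [indicator_of_notMem ht]
  have htail : HasMellin ((Ioi (1 : ℝ)).indicator fun t : ℝ ↦ (t : ℂ)⁻¹) s (-(1 / (s - 1))) := by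
    simp_rw [HasMellin, MellinConvergent, mellin, hfun]
    constructor
    · exact ((integrable_indicator_iff measurableSet_Ioi).2
        (integrableOn_Ioi_cpow_of_lt hre one_pos)).integrableOn
    · rw [setIntegral_indicator measurableSet_Ioi, Ioi_inter_Ioi, max_eq_right zero_le_one,
        integral_Ioi_cpow_of_lt hre one_pos]
      simp only [Complex.ofReal_one, Complex.one_cpow]
      rw [show s - 2 + 1 = s - 1 by ring, neg_div]
  have hsub := hasMellin_sub (differentiableAt_mellin_invExpSubOneReg hs0).1 htail.1
  rw [mellin_invExpSubOneReg hs0 hs, htail.2, sub_neg_eq_add, sub_add_cancel] at hsub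
  have hcongr : ∀ t ∈ Ioi (0 : ℝ), (t : ℂ) ^ (s - 1) • (invExpSubOneReg t -
      (Ioi (1 : ℝ)).indicator (fun t ↦ (t : ℂ)⁻¹) t) =
      (t : ℂ) ^ (s - 1) • (1 / (Complex.exp t - 1) - 1 / (t : ℂ)) := fun t ht ↦ by
    have ht : 0 < t := ht
    rcases le_or_gt t 1 with h | h
    · simp [invExpSubOneReg, ht, h, Complex.cpow_neg_one]
    · simp [invExpSubOneReg, ht, h]
  exact ⟨hsub.1.congr_fun hcongr measurableSet_Ioi,
    (setIntegral_congr_fun measurableSet_Ioi hcongr).symm.trans hsub.2⟩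

lemma image_div_one_add_Ioi : Set.image (fun t : ℝ ↦ t / (1 + t)) (Ioi 0) = Ioo 0 1 := by
  ext x
  constructor
  · rintro ⟨t, ht, rfl⟩
    have ht : 0 < t := ht
    exact ⟨by positivity, (div_lt_one (by positivity)).2 (by linarith)⟩
  · rintro ⟨h0, h1⟩
    have : 1 - x ≠ 0 := by linarith
    refine ⟨x / (1 - x), div_pos h0 (by linarith), ?_⟩
    dsimp only
    field_simp
    ring

/-- The Beta integral over the half-line. -/
lemma hasMellin_inv_one_add {s : ℂ} (hs0 : 0 < s.re) (hs1 : s.re < 1) :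
    HasMellin (fun t : ℝ ↦ (1 + (t : ℂ))⁻¹) s (Complex.Gamma s * Complex.Gamma (1 - s)) := by
  set b : ℝ → ℂ := fun x ↦ (x : ℂ) ^ (s - 1) * (1 - (x : ℂ)) ^ ((1 - s) - 1) with hb
  have hre : 0 < (1 - s).re := by simpa using hs1
  have hderiv : ∀ t ∈ Ioi (0 : ℝ), HasDerivWithinAt (fun t : ℝ ↦ t / (1 + t))
      (1 / (1 + t) ^ 2) (Ioi 0) t := fun t ht ↦ by
    have ht : 0 < t := ht
    have h := ((hasDerivAt_id t).div ((hasDerivAt_id t).const_add 1)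
      (by simp only [id]; positivity)).hasDerivWithinAt (s := Ioi 0)
    convert! h using 1
    simp
  have hinj : InjOn (fun t : ℝ ↦ t / (1 + t)) (Ioi 0) := fun x hx y hy h ↦ by
    have hx : 0 < x := hx
    have hy : 0 < y := hy
    simp only at h
    rw [div_eq_div_iff (by positivity) (by positivity)] at h
    linarith
  have hcongr : ∀ t ∈ Ioi (0 : ℝ), |1 / (1 + t) ^ 2| • b (t / (1 + t)) =
      (t : ℂ) ^ (s - 1) • (1 + (t : ℂ))⁻¹ := fun t ht ↦ by
    have ht : 0 < t := ht
    have hp : 0 < 1 + t := by positivity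
    have hpc : ((1 + t : ℝ) : ℂ) ≠ 0 := by exact_mod_cast hp.ne'
    have e1 : (1 : ℂ) - ((t / (1 + t) : ℝ) : ℂ) = (((1 + t)⁻¹ : ℝ) : ℂ) := by
      rw [← Complex.ofReal_one, ← Complex.ofReal_sub]
      congr 1
      field_simp
      ring
    have e2 : (((1 + t)⁻¹ : ℝ) : ℂ) ^ (s - 1) * (((1 + t)⁻¹ : ℝ) : ℂ) ^ (1 - s - 1) =
        ((1 + t : ℝ) : ℂ) := by
      rw [← Complex.cpow_add _ _ (by simpa using hpc), show s - 1 + (1 - s - 1) = -1 by ring,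
        Complex.cpow_neg_one]
      simp
    rw [abs_of_pos (by positivity), hb]
    dsimp only
    rw [e1, div_eq_mul_inv t, Complex.ofReal_mul,
      Complex.mul_cpow_ofReal_nonneg ht.le (by positivity), mul_assoc, e2, Complex.real_smul,
      smul_eq_mul]
    have hpc' : (1 : ℂ) + t ≠ 0 := by simpa using hpc
    push_cast
    field_simp
  have hint := Complex.betaIntegral_convergent hs0 hre
  rw [intervalIntegrable_iff_integrableOn_Ioo_of_le zero_le_one, ← image_div_one_add_Ioi,
    integrableOn_image_iff_integrableOn_abs_deriv_smul measurableSet_Ioi hderiv hinj] at hint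
  have hval := integral_image_eq_integral_abs_deriv_smul measurableSet_Ioi hderiv hinj b
  rw [setIntegral_congr_fun measurableSet_Ioi hcongr, image_div_one_add_Ioi] at hval
  refine ⟨hint.congr_fun hcongr measurableSet_Ioi, ?_⟩
  rw [mellin, ← hval, Complex.Gamma_mul_Gamma_eq_betaIntegral hs0 hre, Complex.betaIntegral,
    intervalIntegral.integral_of_le zero_le_one, integral_Ioc_eq_integral_Ioo,
    add_sub_cancel, Complex.Gamma_one, one_mul]

lemma hasMellin_inv_add {s : ℂ} (hs0 : 0 < s.re) (hs1 : s.re < 1) {w : ℝ} (hw : 0 < w) :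
    HasMellin (fun t : ℝ ↦ 1 / ((t : ℂ) + w)) s
      (Complex.Gamma s * Complex.Gamma (1 - s) * (w : ℂ) ^ (s - 1)) := by
  have hwc : (w : ℂ) ≠ 0 := by exact_mod_cast hw.ne'
  have hfun : (fun t : ℝ ↦ 1 / ((t : ℂ) + w)) =
      fun t : ℝ ↦ (1 + ((w⁻¹ * t : ℝ) : ℂ))⁻¹ / (w : ℂ) := by
    ext t
    push_cast
    rw [div_eq_mul_inv _ (w : ℂ), ← mul_inv, one_div]
    congr 1
    field_simp
    ring
  have h := hasMellin_inv_one_add hs0 hs1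
  rw [hfun]
  refine ⟨((MellinConvergent.comp_mul_left (inv_pos.2 hw)).2 h.1).div_const _, ?_⟩
  rw [mellin_div_const, mellin_comp_mul_left (fun t : ℝ ↦ (1 + (t : ℂ))⁻¹) s (inv_pos.2 hw), h.2,
    smul_eq_mul, Complex.ofReal_inv, Complex.inv_cpow _ _
      (by rw [Complex.arg_ofReal_of_nonneg hw.le]; exact Real.pi_pos.ne),
    Complex.cpow_neg, inv_inv, Complex.cpow_sub _ _ hwc, Complex.cpow_one]
  ring

lemma norm_inv_exp_sub_one_add_sub_le {t w : ℝ} (ht : 0 < t) (hw : 0 < w) :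
    ‖1 / (Complex.exp t - 1 + w) - 1 / ((t : ℂ) + w)‖ ≤
      ‖1 / (Complex.exp t - 1) - 1 / (t : ℂ)‖ := by
  have h1 : t < Real.exp t - 1 := by linarith [Real.add_one_lt_exp ht.ne']
  have e1 : (1 / (Complex.exp t - 1 + w) - 1 / ((t : ℂ) + w) : ℂ) =
      ((1 / (Real.exp t - 1 + w) - 1 / (t + w) : ℝ) : ℂ) := by push_cast; rfl
  have e2 : (1 / (Complex.exp t - 1) - 1 / (t : ℂ) : ℂ) =
      ((1 / (Real.exp t - 1) - 1 / t : ℝ) : ℂ) := by push_cast; rfl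
  rw [e1, e2, Complex.norm_real, Complex.norm_real, Real.norm_eq_abs, Real.norm_eq_abs]
  set a := Real.exp t - 1
  have ha : 0 < a := ht.trans h1
  rw [div_sub_div _ _ (by positivity) (by positivity), div_sub_div _ _ ha.ne' ht.ne', abs_div,
    abs_div, abs_of_pos (by positivity : 0 < a * t),
    abs_of_pos (by positivity : 0 < (a + w) * (t + w))]
  have e3 : 1 * (t + w) - (a + w) * 1 = 1 * t - a * 1 := by ring
  rw [e3]
  gcongr
  · linarith
  · linarith

theorem F_asymptotic_zeta (z : ℂ) (hz0 : 0 < z.re) (hz1 : z.re < 1) :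
    Tendsto (fun w : ℝ =>
        (1 / Complex.Gamma z) * (∫ t in Set.Ioi (0 : ℝ),
            (t : ℂ) ^ (z - 1) / (Complex.exp t - 1 + w))
          - Complex.Gamma (1 - z) * (w : ℂ) ^ (z - 1))
      (nhdsWithin 0 (Set.Ioi 0)) (nhds (riemannZeta z)) := by
  have hΓ : Complex.Gamma z ≠ 0 := Complex.Gamma_ne_zero_of_re_pos hz0
  have hM := hasMellin_inv_exp_sub_one_sub_inv hz0 hz1
  set d : ℝ → ℝ → ℂ := fun w t ↦
    (t : ℂ) ^ (z - 1) • (1 / (Complex.exp t - 1 + w) - 1 / ((t : ℂ) + w)) with hd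
  have hne1 : ∀ {t w : ℝ}, 0 < t → 0 ≤ w → Complex.exp t - 1 + w ≠ 0 := fun {t w} ht hw ↦ by
    have : Real.exp t - 1 + w ≠ 0 := by linarith [Real.add_one_lt_exp ht.ne']
    exact_mod_cast this
  have hne2 : ∀ {t w : ℝ}, 0 < t → 0 ≤ w → (t : ℂ) + w ≠ 0 := fun {t w} ht hw ↦ by
    have : t + w ≠ 0 := by linarith
    exact_mod_cast this
  have hmeas : ∀ w : ℝ, 0 < w → AEStronglyMeasurable (d w) (volume.restrict (Ioi 0)) :=
      fun w hw ↦ by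
    refine ContinuousOn.aestronglyMeasurable (fun t ht ↦ ?_) measurableSet_Ioi
    have ht : 0 < t := ht
    refine ContinuousAt.continuousWithinAt (ContinuousAt.fun_smul ?_ ?_)
    · exact continuousAt_ofReal_cpow_const _ _ (Or.inr ht.ne')
    · have h1 := hne1 ht hw.le
      have h2 := hne2 ht hw.le
      fun_prop (disch := assumption)
  have hbound : ∀ w : ℝ, 0 < w → ∀ᵐ t ∂volume.restrict (Ioi (0 : ℝ)), ‖d w t‖ ≤
      ‖(t : ℂ) ^ (z - 1) • (1 / (Complex.exp t - 1) - 1 / (t : ℂ))‖ := fun w hw ↦ by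
    filter_upwards [ae_restrict_mem measurableSet_Ioi] with t ht
    rw [hd, norm_smul, norm_smul]
    exact mul_le_mul_of_nonneg_left (norm_inv_exp_sub_one_add_sub_le ht hw) (norm_nonneg _)
  have hlim : Tendsto (fun w ↦ ∫ t in Ioi (0 : ℝ), d w t) (𝓝[>] 0)
      (𝓝 (Complex.Gamma z * riemannZeta z)) := by
    rw [← hM.2]
    refine tendsto_integral_filter_of_dominated_convergence _
      (eventually_mem_nhdsWithin.mono hmeas) (eventually_mem_nhdsWithin.mono hbound) hM.1.norm ?_
    filter_upwards [ae_restrict_mem measurableSet_Ioi] with t ht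
    have ht : 0 < t := ht
    have h1 := hne1 ht le_rfl
    have h2 := hne2 ht le_rfl
    have hc : ContinuousAt (fun w : ℝ ↦ d w t) 0 := by
      simp only [hd]
      fun_prop (disch := assumption)
    have := hc.tendsto.mono_left (nhdsWithin_le_nhds (s := Ioi 0))
    simpa [hd] using this
  have := hlim.const_mul (1 / Complex.Gamma z)
  rw [← mul_assoc, one_div_mul_cancel hΓ, one_mul] at this
  refine this.congr' ?_
  filter_upwards [self_mem_nhdsWithin] with w hw
  have hB := hasMellin_inv_add hz0 hz1 hw
  have hdint : IntegrableOn (d w) (Ioi 0) := hM.1.norm.mono' (hmeas w hw) (hbound w hw)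
  have hsum := integral_add hdint hB.1
  have hB2 := hB.2
  rw [mellin] at hB2
  rw [hB2] at hsum
  have hcongr : ∀ t ∈ Ioi (0 : ℝ), d w t + (t : ℂ) ^ (z - 1) • (1 / ((t : ℂ) + w)) =
      (t : ℂ) ^ (z - 1) / (Complex.exp t - 1 + w) := fun t _ ↦ by
    simp only [hd, smul_eq_mul]
    ring
  rw [setIntegral_congr_fun measurableSet_Ioi hcongr] at hsum
  rw [hsum]
  field_simp
  ring
end

section
/- For 0 < ω < 1 with (1-ω)/ω irrational appropriately (in particular for ω = 1/(1+ln(2π)-γ)), the Fourier transform of φ₀(t) = t/(sinh(ωt)cosh((1-ω)t)) at real k > 0 equals 2π² Σ_{n=1}^∞ (-1)^{n-1} [ n e^{-nπk/ω}/(ω² cos(nπ(1-ω)/ω)) + (n-1/2) e^{-(n-1/2)πk/(1-ω)}/((1-ω)² sin((n-1/2)πω/(1-ω))) ], assuming all the cosines and sines appearing are nonzero and the series converges absolutely. -/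
open Real Complex MeasureTheory

/-- `φ₀(t) = t / (sinh(ωt) cosh((1-ω)t))` for `t ≠ 0`, with `φ₀(0) = 1/ω`. -/
noncomputable def phi0 (ω t : ℝ) : ℝ :=
  if t = 0 then 1 / ω else t / (Real.sinh (ω * t) * Real.cosh ((1 - ω) * t))

/-- The `n`-th (for `n = 1, 2, 3, …`, indexed here by `n : ℕ+`) term of the
residue series for the Fourier transform of `φ₀`:
`(-1)^{n-1} [ n e^{-nπk/ω}/(ω² cos(nπ(1-ω)/ω))
  + (n-1/2) e^{-(n-1/2)πk/(1-ω)}/((1-ω)² sin((n-1/2)πω/(1-ω))) ]`. -/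
noncomputable def phi0FTterm (ω k : ℝ) (n : ℕ+) : ℝ :=
  (-1 : ℝ) ^ ((n : ℕ) - 1) *
    ((n : ℝ) * Real.exp (-(n : ℝ) * π * k / ω) /
        (ω ^ 2 * Real.cos ((n : ℝ) * π * (1 - ω) / ω))
      + ((n : ℝ) - 1 / 2) * Real.exp (-((n : ℝ) - 1 / 2) * π * k / (1 - ω)) /
        ((1 - ω) ^ 2 * Real.sin (((n : ℝ) - 1 / 2) * π * ω / (1 - ω))))

open Filter Topology

lemma integrable_of_continuous_of_norm_le_div_sq {g : ℝ → ℂ} (hg : Continuous g) {K : ℝ}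
    (hK : ∀ x, 1 ≤ |x| → ‖g x‖ ≤ K / x ^ 2) : Integrable g := by
  obtain ⟨M, hM⟩ := (isCompact_Icc (a := (-1 : ℝ)) (b := 1)).exists_bound_of_continuousOn
    hg.continuousOn
  have hK0 : 0 ≤ K := by simpa using (norm_nonneg _).trans (hK 1 (by simp))
  have hM0 : 0 ≤ M := (norm_nonneg _).trans (hM 0 (by simp))
  refine (integrable_inv_one_add_sq.const_mul (2 * K + 2 * M)).mono' hg.aestronglyMeasurable
    (Eventually.of_forall fun x => ?_)
  rw [← div_eq_mul_inv]
  rcases le_total 1 |x| with h | h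
  · have hx : 1 ≤ x ^ 2 := by rw [← sq_abs]; nlinarith
    refine (hK x h).trans ?_
    rw [div_le_div_iff₀ (by positivity) (by positivity)]
    nlinarith [mul_nonneg hM0 (sq_nonneg x), mul_nonneg hK0 (sub_nonneg.2 hx)]
  · have hx : x ^ 2 ≤ 1 := by rw [← sq_abs]; nlinarith [abs_nonneg x]
    refine (hM x (abs_le.1 h)).trans ?_
    rw [le_div_iff₀ (by positivity)]
    nlinarith [mul_nonneg hM0 (sub_nonneg.2 hx)]

lemma integral_eq_integral_add_mul_I {f : ℂ → ℂ} {R : ℝ} (hR : 0 < R)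
    (hf : ∀ z : ℂ, 0 ≤ z.im → z.im ≤ R → DifferentiableAt ℂ f z)
    {K : ℝ} (hK : ∀ z : ℂ, 0 ≤ z.im → z.im ≤ R → 1 ≤ |z.re| → ‖f z‖ ≤ K / z.re ^ 2) :
    ∫ x : ℝ, f x = ∫ x : ℝ, f (x + R * I) := by
  have hline : ∀ v : ℝ, 0 ≤ v → v ≤ R → Integrable fun x : ℝ => f (x + v * I) := by
    intro v h0 h1
    refine integrable_of_continuous_of_norm_le_div_sq (K := K) ?_ fun x hx => ?_
    · refine continuous_iff_continuousAt.2 fun x => ?_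
      have h : ContinuousAt f (x + v * I) := (hf _ (by simpa) (by simpa)).continuousAt
      exact ContinuousAt.comp (f := fun x : ℝ => (x + v * I : ℂ)) h (by fun_prop)
    · simpa using hK (x + v * I) (by simpa) (by simpa) (by simpa)
  have hT : ∀ v : ℝ, 0 ≤ v → v ≤ R → Tendsto (fun T : ℝ => ∫ x in (-T)..T, f (x + v * I)) atTop
      (𝓝 (∫ x : ℝ, f (x + v * I))) := fun v h0 h1 =>
    intervalIntegral_tendsto_integral (hline v h0 h1) tendsto_neg_atTop_atBot tendsto_id
  have hside : ∀ e : ℝ → ℝ, (∀ T, |e T| = |T|) →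
      Tendsto (fun T : ℝ => ∫ y in (0 : ℝ)..R, f (e T + y * I)) atTop (𝓝 0) := by
    intro e he
    have hlim : Tendsto (fun T : ℝ => K / T ^ 2 * |R - 0|) atTop (𝓝 0) := by
      have : Tendsto (fun T : ℝ => K / T ^ 2) atTop (𝓝 0) :=
        tendsto_const_nhds.div_atTop (tendsto_pow_atTop two_ne_zero)
      simpa using this.mul_const |R - 0|
    refine squeeze_zero_norm' ?_ hlim
    filter_upwards [eventually_ge_atTop 1] with T hT
    refine intervalIntegral.norm_integral_le_of_norm_le_const fun y hy => ?_
    rw [Set.uIoc_of_le hR.le] at hy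
    have := hK (e T + y * I) (by simpa using hy.1.le) (by simpa using hy.2)
      (by simpa [he] using hT.trans (le_abs_self T))
    have h2 : e T ^ 2 = T ^ 2 := by rw [← sq_abs, he, sq_abs]
    simpa [h2] using this
  have hrect : ∀ T : ℝ, (∫ x in (-T)..T, f (x + (0 : ℝ) * I)) - (∫ x in (-T)..T, f (x + R * I)) +
      I * (∫ y in (0 : ℝ)..R, f (T + y * I)) - I * (∫ y in (0 : ℝ)..R, f ((-T : ℝ) + y * I)) = 0 := by
    intro T
    have := integral_boundary_rect_eq_zero_of_differentiableOn f (⟨-T, 0⟩) ⟨T, R⟩ ?_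
    · simpa using this
    · intro z hz
      rw [mem_reProdIm] at hz
      simp only [Set.uIcc_of_le hR.le] at hz
      exact (hf z hz.2.1 hz.2.2).differentiableWithinAt
  have hlim := (((hT 0 le_rfl hR.le).sub (hT R hR.le le_rfl)).add
    ((hside id fun _ => rfl).const_mul I)).sub ((hside (fun T => -T) abs_neg).const_mul I)
  have h0 := tendsto_nhds_unique hlim
    (tendsto_const_nhds.congr fun T => (hrect T).symm)
  simpa [sub_eq_zero] using h0

lemma integral_inv_sub_sub_inv_add {y : ℝ} (hy : 0 < y) :
    ∫ x : ℝ, (((x : ℂ) - y * I)⁻¹ - ((x : ℂ) + y * I)⁻¹) = 2 * π * I := by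
  have h1 : ∀ x : ℝ, ((x : ℂ) - y * I)⁻¹ - ((x : ℂ) + y * I)⁻¹ =
      (2 * I) * (((y⁻¹ * (1 + (x / y) ^ 2)⁻¹ : ℝ)) : ℂ) := by
    intro x
    have ha : (x : ℂ) - y * I ≠ 0 := fun h => hy.ne' (by simpa using congrArg Complex.im h)
    have hb : (x : ℂ) + y * I ≠ 0 := fun h => hy.ne' (by simpa using congrArg Complex.im h)
    have hc : ((y ^ 2 + x ^ 2 : ℝ) : ℂ) ≠ 0 := by
      exact_mod_cast (by positivity : y ^ 2 + x ^ 2 ≠ 0)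
    have hd : y⁻¹ * (1 + (x / y) ^ 2)⁻¹ = y / (y ^ 2 + x ^ 2) := by field_simp
    rw [hd]
    push_cast at hc ⊢
    field_simp
    ring_nf
    simp only [I_pow_three]
    ring
  simp_rw [h1]
  rw [integral_const_mul, integral_complex_ofReal, integral_const_mul]
  rw [Measure.integral_comp_div (fun x : ℝ => (1 + x ^ 2)⁻¹) y, integral_univ_inv_one_add_sq]
  simp only [smul_eq_mul, abs_of_pos hy]
  rw [inv_mul_cancel_left₀ hy.ne']
  ring

lemma norm_inv_add_sub_inv_add_le (z : ℂ) (a b : ℝ) (h : 1 ≤ |z.re|) :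
    ‖(z + a * I)⁻¹ - (z + b * I)⁻¹‖ ≤ |b - a| / z.re ^ 2 := by
  have hre : ∀ c : ℝ, |z.re| ≤ ‖z + c * I‖ := fun c => by
    simpa using abs_re_le_norm (z + c * I)
  have hne : ∀ c : ℝ, z + c * I ≠ 0 := fun c => norm_pos_iff.1 (by linarith [hre c])
  rw [inv_sub_inv (hne a) (hne b), norm_div, norm_mul, ← sq_abs z.re, sq]
  have hnum : z + b * I - (z + a * I) = ((b - a : ℝ) : ℂ) * I := by push_cast; ring
  rw [hnum, norm_mul, norm_I, mul_one, norm_real, Real.norm_eq_abs]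
  have := hre a
  have := hre b
  gcongr

lemma integrable_inv_add_sub_inv_add {a b : ℝ} (ha : a ≠ 0) (hb : b ≠ 0) :
    Integrable fun x : ℝ => ((x : ℂ) + a * I)⁻¹ - ((x : ℂ) + b * I)⁻¹ := by
  have hne : ∀ c : ℝ, c ≠ 0 → ∀ x : ℝ, (x : ℂ) + c * I ≠ 0 := fun c hc x h =>
    hc (by simpa using congrArg Complex.im h)
  refine integrable_of_continuous_of_norm_le_div_sq (K := |b - a|) ?_ fun x hx => ?_
  · exact (Continuous.inv₀ (by fun_prop) (hne a ha)).sub (Continuous.inv₀ (by fun_prop) (hne b hb))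
  · simpa using norm_inv_add_sub_inv_add_le x a b (by simpa)

lemma integral_inv_add_sub_inv_add {a b : ℝ} (ha : 0 < a) (hb : 0 < b) :
    ∫ x : ℝ, (((x : ℂ) + a * I)⁻¹ - ((x : ℂ) + b * I)⁻¹) = 0 := by
  set J := ∫ x : ℝ, (((x : ℂ) + a * I)⁻¹ - ((x : ℂ) + b * I)⁻¹) with hJ
  have hJ' : J = ∫ x : ℝ, (((x : ℂ) - b * I)⁻¹ - ((x : ℂ) - a * I)⁻¹) := by
    rw [hJ, ← integral_neg_eq_self]
    refine integral_congr_ae (Eventually.of_forall fun x => ?_)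
    have h : ∀ c : ℝ, ((-x : ℝ) : ℂ) + c * I = -((x : ℂ) - c * I) := fun c => by push_cast; ring
    simp only [h, inv_neg]
    ring
  have hs : ∀ y : ℝ, 0 < y →
      Integrable fun x : ℝ => ((x : ℂ) - y * I)⁻¹ - ((x : ℂ) + y * I)⁻¹ := fun y hy => by
    simpa [sub_eq_add_neg] using
      integrable_inv_add_sub_inv_add (neg_ne_zero.2 hy.ne') hy.ne'
  have hsum : J + J = 0 := by
    nth_rewrite 2 [hJ']
    rw [hJ, ← integral_add (integrable_inv_add_sub_inv_add ha.ne' hb.ne')]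
    · have := integral_sub (hs b hb) (hs a ha)
      rw [integral_inv_sub_sub_inv_add ha, integral_inv_sub_sub_inv_add hb, sub_self] at this
      rw [← this]
      congr 1
      ext x
      ring
    · simpa [sub_eq_add_neg] using
        integrable_inv_add_sub_inv_add (neg_ne_zero.2 hb.ne') (neg_ne_zero.2 ha.ne')
  exact self_eq_neg.1 (eq_neg_of_add_eq_zero_left hsum)

/-- Shifting the contour of integration of a meromorphic function with finitely many simple poles
on the imaginary axis. -/
lemma integral_sub_integral_add_mul_I_eq_sum {ι : Type*} [DecidableEq ι] {R : ℝ} (hR : 0 < R)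
    (y : ι → ℝ) (r : ι → ℂ) (s : Finset ι) : ∀ (f : ℂ → ℂ) (K : ℝ), Set.InjOn y s →
    (∀ i ∈ s, 0 < y i ∧ y i < R) →
    (∀ z : ℂ, 0 ≤ z.im → z.im ≤ R → (∀ i ∈ s, z ≠ y i * I) → DifferentiableAt ℂ f z) →
    (∀ i ∈ s, Tendsto (fun z => (z - y i * I) * f z) (𝓝[≠] (y i * I)) (𝓝 (r i))) →
    (∀ z : ℂ, 0 ≤ z.im → z.im ≤ R → 1 ≤ |z.re| → ‖f z‖ ≤ K / z.re ^ 2) →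
    (∫ x : ℝ, f x) - ∫ x : ℝ, f (x + R * I) = 2 * π * I * ∑ i ∈ s, r i := by
  induction s using Finset.induction_on with
  | empty =>
    intro f K _ _ hf _ hK
    simp [integral_eq_integral_add_mul_I hR (fun z h0 h1 => hf z h0 h1 (by simp)) hK]
  | insert j s hj ih =>
    intro f K hinj hy hf hr hK
    set p : ℂ := y j * I with hp
    obtain ⟨hy0, hyR⟩ := hy j (Finset.mem_insert_self j s)
    have hpne : ∀ i ∈ s, (y i * I : ℂ) ≠ p := by
      intro i hi h
      have : y i = y j := by simpa [hp] using h
      exact hj (hinj (by simp [hi]) (by simp) this ▸ hi)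
    set F : ℂ → ℂ := Function.update (fun z => (z - p) * f z) p (r j) with hF
    have hFp : F p = r j := by simp [hF]
    have hFne : ∀ z, z ≠ p → F z = (z - p) * f z := fun z hz => by simp [hF, hz]
    have hFev : ∀ z, z ≠ p → F =ᶠ[𝓝 z] fun z => (z - p) * f z := fun z hz => by
      filter_upwards [isOpen_ne.mem_nhds hz] with w hw using hFne w hw
    have hFan : AnalyticAt ℂ F p := by
      refine analyticAt_of_differentiable_on_punctured_nhds_of_continuousAt ?_ ?_
      · have h1 : ∀ᶠ z in 𝓝[≠] p, z ∈ {z : ℂ | 0 < z.im} ∩ {z : ℂ | z.im < R} :=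
          mem_nhdsWithin_of_mem_nhds (((isOpen_lt continuous_const continuous_im).inter
            (isOpen_lt continuous_im continuous_const)).mem_nhds (by simp [hp, hy0, hyR]))
        have h2 : ∀ᶠ z in 𝓝[≠] p, ∀ i ∈ s, z ≠ y i * I := by
          refine mem_nhdsWithin_of_mem_nhds ?_
          exact (Filter.eventually_all_finset s).2 fun i hi => isOpen_ne.mem_nhds (hpne i hi).symm
        filter_upwards [h1, h2, self_mem_nhdsWithin] with z hz hz2 hz3
        refine DifferentiableAt.congr_of_eventuallyEq ?_ (hFev z hz3)
        refine DifferentiableAt.mul (by fun_prop) (hf z hz.1.le hz.2.le ?_)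
        intro i hi
        rcases Finset.mem_insert.1 hi with rfl | hi
        exacts [hz3, hz2 i hi]
      · exact continuousAt_update_same.2 (hr j (Finset.mem_insert_self j s))
    set f₁ : ℂ → ℂ := fun z => dslope F p z + r j * (z + y j * I)⁻¹ with hf₁
    have hf₁ne : ∀ z, z ≠ p → f₁ z = f z - r j * ((z - p)⁻¹ - (z + y j * I)⁻¹) := fun z hz => by
      have := sub_ne_zero.2 hz
      rw [hf₁]
      simp only
      rw [dslope_of_ne _ hz, slope_def_field, hFp, hFne z hz]
      field_simp
      ring
    have hplus : ∀ z : ℂ, 0 ≤ z.im → z + y j * I ≠ 0 := fun z hz h => by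
      have : z.im + y j = 0 := by simpa using congrArg Complex.im h
      linarith
    have hK1 : ∀ z : ℂ, 0 ≤ z.im → z.im ≤ R → 1 ≤ |z.re| →
        ‖f₁ z‖ ≤ (K + ‖r j‖ * |y j - -y j|) / z.re ^ 2 := by
      intro z h0 h1 h2
      have hzp : z ≠ p := by
        rintro rfl
        norm_num [hp] at h2
      rw [hf₁ne z hzp, add_div, mul_div_assoc]
      refine (norm_sub_le _ _).trans (add_le_add (hK z h0 h1 h2) ?_)
      rw [norm_mul]
      have := norm_inv_add_sub_inv_add_le z (-y j) (y j) h2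
      gcongr
      simpa [hp, sub_eq_add_neg] using this
    have key := ih f₁ _ (hinj.mono (by simp)) (fun i hi => hy i (by simp [hi])) ?_ ?_ hK1
    · rw [Finset.sum_insert hj, mul_add, ← key]
      have hline : ∀ v : ℝ, 0 ≤ v → v ≤ R → (∀ i ∈ insert j s, y i ≠ v) →
          Integrable fun x : ℝ => f (x + v * I) := by
        intro v h0 h1 hv
        refine integrable_of_continuous_of_norm_le_div_sq (K := K) ?_ fun x hx => ?_
        · refine continuous_iff_continuousAt.2 fun x => ?_
          have h : ContinuousAt f (x + v * I) := (hf _ (by simpa) (by simpa) fun i hi h =>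
            hv i hi (by simpa using (congrArg Complex.im h).symm)).continuousAt
          exact ContinuousAt.comp (f := fun x : ℝ => (x + v * I : ℂ)) h (by fun_prop)
        · simpa using hK (x + v * I) (by simpa) (by simpa) (by simpa)
      have h0 : ∫ x : ℝ, f₁ x = (∫ x : ℝ, f x) - r j * (2 * π * I) := by
        have hne : ∀ x : ℝ, (x : ℂ) ≠ p := fun x h =>
          hy0.ne (by simpa [hp] using congrArg Complex.im h)
        simp_rw [hf₁ne _ (hne _)]
        rw [integral_sub, integral_const_mul, integral_inv_sub_sub_inv_add hy0]
        · simpa using hline 0 le_rfl hR.le fun i hi => (hy i hi).1.ne'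
        · simpa [hp, sub_eq_add_neg] using
            (integrable_inv_add_sub_inv_add (neg_ne_zero.2 hy0.ne') hy0.ne').const_mul (r j)
      have h1 : ∫ x : ℝ, f₁ (x + R * I) = ∫ x : ℝ, f (x + R * I) := by
        have hne : ∀ x : ℝ, (x + R * I : ℂ) ≠ p := fun x h =>
          hyR.ne' (by simpa [hp] using congrArg Complex.im h)
        simp_rw [hf₁ne _ (hne _)]
        have hsh : ∀ x : ℝ, ((x + R * I - p)⁻¹ - (x + R * I + y j * I)⁻¹ : ℂ) =
            ((x : ℂ) + (R - y j : ℝ) * I)⁻¹ - (x + (R + y j : ℝ) * I)⁻¹ := fun x => by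
          push_cast
          rw [hp]
          congr 2 <;> ring
        simp_rw [hsh]
        rw [integral_sub, integral_const_mul,
          integral_inv_add_sub_inv_add (by linarith) (by linarith), mul_zero, sub_zero]
        · exact hline R hR.le le_rfl fun i hi => (hy i hi).2.ne
        · exact (integrable_inv_add_sub_inv_add (by linarith) (by linarith)).const_mul (r j)
      rw [h0, h1]
      ring
    · intro z h0 h1 hz
      refine DifferentiableAt.add ?_ (DifferentiableAt.const_mul (DifferentiableAt.fun_inv
        (h := fun z : ℂ => z + y j * I) (by fun_prop) (hplus z h0)) _)
      by_cases hzp : z = p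
      · rw [hzp]
        obtain ⟨U, hU, hd⟩ := hFan.exists_mem_nhds_analyticOnNhd
        exact ((differentiableOn_dslope hU).2 hd.differentiableOn).differentiableAt hU
      · rw [differentiableAt_dslope_of_ne hzp]
        refine DifferentiableAt.congr_of_eventuallyEq ?_ (hFev z hzp)
        refine DifferentiableAt.mul (by fun_prop) (hf z h0 h1 ?_)
        intro i hi
        rcases Finset.mem_insert.1 hi with rfl | hi
        exacts [hzp, hz i hi]
    · intro i hi
      have hne := hpne i hi
      have hi0 := (hy i (by simp [hi])).1
      have hev : ∀ᶠ z in 𝓝[≠] (y i * I : ℂ), (z - y i * I) * f z -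
          (z - y i * I) * (r j * ((z - p)⁻¹ - (z + y j * I)⁻¹)) = (z - y i * I) * f₁ z := by
        filter_upwards [mem_nhdsWithin_of_mem_nhds (isOpen_ne.mem_nhds hne)] with z hz
        rw [hf₁ne z hz]
        ring
      refine Tendsto.congr' hev ?_
      have hc : ContinuousAt (fun z : ℂ => (z - y i * I) *
          (r j * ((z - p)⁻¹ - (z + y j * I)⁻¹))) (y i * I) := by
        have h1 := sub_ne_zero.2 hne
        have h2 := hplus (y i * I) (by simpa using hi0.le)
        fun_prop (disch := assumption)
      simpa using (hr i (by simp [hi])).sub (hc.tendsto.mono_left nhdsWithin_le_nhds)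

lemma norm_sinh_sq (z : ℂ) :
    ‖Complex.sinh z‖ ^ 2 = Real.sinh z.re ^ 2 + Real.sin z.im ^ 2 := by
  have h : Complex.sinh z = ((Real.sinh z.re * Real.cos z.im : ℝ) : ℂ) +
      ((Real.cosh z.re * Real.sin z.im : ℝ) : ℂ) * I := by
    conv_lhs => rw [← re_add_im z]
    rw [Complex.sinh_add, Complex.cosh_mul_I, Complex.sinh_mul_I]
    push_cast
    ring
  rw [h, ← Complex.normSq_eq_norm_sq, Complex.normSq_add_mul_I]
  have h1 := Real.cosh_sq z.re
  have h2 := Real.sin_sq_add_cos_sq z.im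
  linear_combination Real.sin z.im ^ 2 * h1 + Real.sinh z.re ^ 2 * h2

lemma norm_cosh_sq (z : ℂ) :
    ‖Complex.cosh z‖ ^ 2 = Real.sinh z.re ^ 2 + Real.cos z.im ^ 2 := by
  have h : Complex.cosh z = ((Real.cosh z.re * Real.cos z.im : ℝ) : ℂ) +
      ((Real.sinh z.re * Real.sin z.im : ℝ) : ℂ) * I := by
    conv_lhs => rw [← re_add_im z]
    rw [Complex.cosh_add, Complex.cosh_mul_I, Complex.sinh_mul_I]
    push_cast
    ring
  rw [h, ← Complex.normSq_eq_norm_sq, Complex.normSq_add_mul_I]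
  have h1 := Real.cosh_sq z.re
  have h2 := Real.sin_sq_add_cos_sq z.im
  linear_combination Real.cos z.im ^ 2 * h1 + Real.sinh z.re ^ 2 * h2

lemma sq_le_sinh_sq (u : ℝ) : u ^ 2 ≤ Real.sinh u ^ 2 := by
  rw [← sq_abs u, ← sq_abs (Real.sinh u), Real.abs_sinh]
  have := Real.self_le_sinh_iff.2 (abs_nonneg u)
  gcongr

lemma pow_four_div_four_le_sinh_sq (u : ℝ) : u ^ 4 / 4 ≤ Real.sinh u ^ 2 := by
  have h := sq_le_sinh_sq (u / 2)
  have h2 : Real.sinh u = 2 * Real.sinh (u / 2) * Real.cosh (u / 2) := by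
    rw [← Real.sinh_two_mul]; congr 1; ring
  rw [h2, mul_pow, mul_pow, Real.cosh_sq]
  have h3 : (u / 2) ^ 2 * (u / 2) ^ 2 ≤ Real.sinh (u / 2) ^ 2 * (Real.sinh (u / 2) ^ 2 + 1) :=
    mul_le_mul h (by linarith) (by positivity) (by positivity)
  nlinarith

/-- The entire function `sinh(ωz) cosh((1-ω)z) / z`, with its value at `0` filled in. -/
noncomputable def phi0Denom (ω : ℝ) (z : ℂ) : ℂ :=
  dslope (fun w : ℂ => Complex.sinh (ω * w)) 0 z * Complex.cosh ((1 - ω) * z)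

lemma differentiable_phi0Denom (ω : ℝ) : Differentiable ℂ (phi0Denom ω) := by
  have h : Differentiable ℂ (dslope (fun w : ℂ => Complex.sinh (ω * w)) 0) := by
    rw [← differentiableOn_univ, differentiableOn_dslope univ_mem, differentiableOn_univ]
    fun_prop
  exact h.mul (by fun_prop)

lemma phi0Denom_of_ne (ω : ℝ) {z : ℂ} (hz : z ≠ 0) :
    phi0Denom ω z = Complex.sinh (ω * z) * Complex.cosh ((1 - ω) * z) / z := by
  rw [phi0Denom, dslope_of_ne _ hz, slope_def_field]
  simp
  ring

lemma phi0Denom_zero (ω : ℝ) : phi0Denom ω 0 = ω := by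
  have h : HasDerivAt (fun w : ℂ => Complex.sinh (ω * w)) ω 0 := by
    simpa using ((hasDerivAt_id (0 : ℂ)).const_mul (ω : ℂ)).csinh
  simp [phi0Denom, h.deriv]

lemma ofReal_phi0 (ω t : ℝ) : (phi0 ω t : ℂ) = (phi0Denom ω t)⁻¹ := by
  rcases eq_or_ne t 0 with rfl | ht
  · simp [phi0, phi0Denom_zero]
  · rw [phi0Denom_of_ne _ (by exact_mod_cast ht)]
    simp [phi0, ht]

lemma norm_sinh_mul_sq (ω : ℝ) (z : ℂ) :
    ‖Complex.sinh (ω * z)‖ ^ 2 = Real.sinh (ω * z.re) ^ 2 + Real.sin (ω * z.im) ^ 2 := by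
  simp [norm_sinh_sq]

lemma norm_cosh_mul_sq (ω : ℝ) (z : ℂ) :
    ‖Complex.cosh ((1 - ω) * z)‖ ^ 2 =
      Real.sinh ((1 - ω) * z.re) ^ 2 + Real.cos ((1 - ω) * z.im) ^ 2 := by
  simp [norm_cosh_sq]

/-- The only zeros of `phi0Denom ω` in the closed upper half plane are the poles of `φ₀`. -/
lemma phi0Denom_ne_zero {ω : ℝ} (hω0 : 0 < ω) (hω1 : ω < 1) {z : ℂ} (hz : 0 ≤ z.im)
    (h1 : ∀ i : ℕ, z ≠ (((i + 1) * π / ω : ℝ) : ℂ) * I)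
    (h2 : ∀ j : ℕ, z ≠ (((j + 1 / 2) * π / (1 - ω) : ℝ) : ℂ) * I) : phi0Denom ω z ≠ 0 := by
  rcases eq_or_ne z 0 with rfl | hz0
  · simpa [phi0Denom_zero] using hω0.ne'
  have hω1' : 0 < 1 - ω := by linarith
  have hext : z.re = 0 → z = (z.im : ℂ) * I := fun h => by
    apply Complex.ext <;> simp [h]
  rw [phi0Denom_of_ne _ hz0, div_ne_zero_iff, mul_ne_zero_iff]
  refine ⟨⟨fun h => ?_, fun h => ?_⟩, hz0⟩
  · have := norm_sinh_mul_sq ω z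
    rw [h, norm_zero] at this
    have hs : Real.sinh (ω * z.re) = 0 := by nlinarith [sq_nonneg (Real.sin (ω * z.im))]
    have ht : Real.sin (ω * z.im) = 0 := by nlinarith [sq_nonneg (Real.sinh (ω * z.re))]
    have hre : z.re = 0 := by simpa [hω0.ne'] using hs
    obtain ⟨n, hn⟩ := Real.sin_eq_zero_iff.1 ht
    have hn1 : 1 ≤ n := by
      by_contra! hcon
      have : (n : ℝ) ≤ 0 := by exact_mod_cast (by omega : n ≤ 0)
      have h3 : ω * z.im ≤ 0 := by rw [← hn]; exact mul_nonpos_of_nonpos_of_nonneg this pi_pos.le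
      have h4 : z.im = 0 := le_antisymm (nonpos_of_mul_nonpos_right h3 hω0) hz
      exact hz0 (Complex.ext hre h4)
    obtain ⟨i, rfl⟩ : ∃ i : ℕ, n = i + 1 := ⟨(n - 1).toNat, by omega⟩
    refine h1 i ((hext hre).trans ?_)
    congr 2
    rw [eq_div_iff hω0.ne']
    push_cast at hn
    linarith
  · have := norm_cosh_mul_sq ω z
    rw [h, norm_zero] at this
    have hs : Real.sinh ((1 - ω) * z.re) = 0 := by nlinarith [sq_nonneg (Real.cos ((1 - ω) * z.im))]
    have ht : Real.cos ((1 - ω) * z.im) = 0 := by nlinarith [sq_nonneg (Real.sinh ((1 - ω) * z.re))]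
    have hre : z.re = 0 := by simpa [hω1'.ne'] using hs
    obtain ⟨n, hn⟩ := Real.cos_eq_zero_iff.1 ht
    have hn0 : 0 ≤ n := by
      by_contra! hcon
      have : (n : ℝ) ≤ -1 := by exact_mod_cast (by omega : n ≤ -1)
      nlinarith [pi_pos, mul_nonneg hω1'.le hz]
    obtain ⟨j, rfl⟩ : ∃ j : ℕ, n = j := ⟨n.toNat, by omega⟩
    refine h2 j ((hext hre).trans ?_)
    congr 2
    rw [eq_div_iff hω1'.ne']
    push_cast at hn
    linarith

lemma norm_cexp_I_mul (k : ℝ) (z : ℂ) : ‖cexp (I * k * z)‖ = Real.exp (-(k * z.im)) := by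
  simp [Complex.norm_exp]

lemma norm_div_phi0Denom (ω k : ℝ) {z : ℂ} (hz : z ≠ 0) :
    ‖cexp (I * k * z) / phi0Denom ω z‖ = ‖z‖ * Real.exp (-(k * z.im)) /
      (‖Complex.sinh (ω * z)‖ * ‖Complex.cosh ((1 - ω) * z)‖) := by
  rw [phi0Denom_of_ne _ hz, norm_div, norm_cexp_I_mul, norm_div, norm_mul]
  field_simp

lemma norm_div_phi0Denom_le {ω k R : ℝ} (hω0 : 0 < ω) (hω1 : ω < 1) (hk : 0 < k) {z : ℂ}
    (hz0 : 0 ≤ z.im) (hzR : z.im ≤ R) (hz : 1 ≤ |z.re|) :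
    ‖cexp (I * k * z) / phi0Denom ω z‖ ≤ (1 + R) * 2 / (ω * (1 - ω) ^ 2) / z.re ^ 2 := by
  have hω1' : 0 < 1 - ω := by linarith
  have hne : z ≠ 0 := by rintro rfl; norm_num at hz
  have hx : 0 < |z.re| := by linarith
  have hs : ω * |z.re| ≤ ‖Complex.sinh (ω * z)‖ := by
    refine le_of_sq_le_sq ?_ (norm_nonneg _)
    rw [norm_sinh_mul_sq, mul_pow, sq_abs, ← mul_pow]
    nlinarith [sq_le_sinh_sq (ω * z.re), sq_nonneg (Real.sin (ω * z.im))]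
  have hc : (1 - ω) ^ 2 * |z.re| ^ 2 / 2 ≤ ‖Complex.cosh ((1 - ω) * z)‖ := by
    refine le_of_sq_le_sq ?_ (norm_nonneg _)
    rw [norm_cosh_mul_sq, sq_abs]
    nlinarith [pow_four_div_four_le_sinh_sq ((1 - ω) * z.re), sq_nonneg (Real.cos ((1 - ω) * z.im))]
  have hn : ‖z‖ ≤ (1 + R) * |z.re| := by
    have := Complex.norm_le_abs_re_add_abs_im z
    rw [abs_of_nonneg hz0] at this
    nlinarith
  have he : Real.exp (-(k * z.im)) ≤ 1 := Real.exp_le_one_iff.2 (by nlinarith)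
  rw [norm_div_phi0Denom _ _ hne]
  have hR : 0 ≤ R := hz0.trans hzR
  calc _ ≤ (1 + R) * |z.re| * 1 / (ω * |z.re| * ((1 - ω) ^ 2 * |z.re| ^ 2 / 2)) := by gcongr
    _ = _ := by rw [← sq_abs z.re]; field_simp

lemma norm_div_phi0Denom_le_of_height {ω k c : ℝ} (hω0 : 0 < ω) (hω1 : ω < 1) (hc0 : 0 < c) :
    ∃ K : ℝ, ∀ R, 0 < R → c ≤ |Real.sin (ω * R)| → c ≤ |Real.cos ((1 - ω) * R)| → ∀ x : ℝ,
      ‖cexp (I * k * (x + R * I)) / phi0Denom ω (x + R * I)‖ ≤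
        K * ((1 + R) * Real.exp (-(k * R))) * (1 + x ^ 2)⁻¹ := by
  have hω1' : 0 < 1 - ω := by linarith
  obtain ⟨a, ha0, hac, haω⟩ : ∃ a > 0, a ≤ c ∧ a ≤ ω := ⟨min c ω, by positivity, by simp, by simp⟩
  obtain ⟨b, hb0, hbc, hbω⟩ : ∃ b > 0, b ≤ c ∧ b ≤ (1 - ω) ^ 2 / 2 :=
    ⟨min c ((1 - ω) ^ 2 / 2), by positivity, by simp, by simp⟩
  refine ⟨2 / (a * b), fun R hR hs hc x => ?_⟩
  have hne : (x + R * I : ℂ) ≠ 0 := fun h => hR.ne' (by simpa using congrArg Complex.im h)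
  set w := Real.sqrt (1 + x ^ 2) with hw
  have hw2 : w ^ 2 = 1 + x ^ 2 := Real.sq_sqrt (by positivity)
  have hw0 : 0 < w := Real.sqrt_pos.2 (by positivity)
  have h1 : a * w ≤ ‖Complex.sinh (ω * (x + R * I))‖ := by
    refine le_of_sq_le_sq ?_ (norm_nonneg _)
    rw [norm_sinh_mul_sq, mul_pow, hw2]
    have e1 : a ^ 2 ≤ Real.sin (ω * R) ^ 2 := by
      rw [← sq_abs (Real.sin _)]; gcongr; linarith
    have e2 : a ^ 2 * x ^ 2 ≤ ω ^ 2 * x ^ 2 := by gcongr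
    have e3 := sq_le_sinh_sq (ω * x)
    simp
    linarith
  have h2 : b * w ^ 2 / 2 ≤ ‖Complex.cosh ((1 - ω) * (x + R * I))‖ := by
    refine le_of_sq_le_sq ?_ (norm_nonneg _)
    rw [norm_cosh_mul_sq, hw2]
    have e1 : b ^ 2 ≤ Real.cos ((1 - ω) * R) ^ 2 := by
      rw [← sq_abs (Real.cos _)]; gcongr; linarith
    have e2 : b ^ 2 * x ^ 4 ≤ ((1 - ω) ^ 2 / 2) ^ 2 * x ^ 4 := by gcongr
    have e3 := pow_four_div_four_le_sinh_sq ((1 - ω) * x)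
    have e4 : (b * (1 + x ^ 2) / 2) ^ 2 ≤ b ^ 2 + b ^ 2 * x ^ 4 := by
      have : 0 ≤ b ^ 2 * ((x ^ 2 - 1) ^ 2 + 2 * x ^ 4 + 2) := by positivity
      nlinarith
    simp
    linarith
  have hn : ‖(x + R * I : ℂ)‖ ≤ (1 + R) * w := by
    have := Complex.norm_le_abs_re_add_abs_im (x + R * I)
    simp [abs_of_pos hR] at this
    have hx : |x| ≤ w := Real.abs_le_sqrt (by linarith)
    have hw1 : 1 ≤ w := Real.one_le_sqrt.2 (by nlinarith)
    nlinarith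
  rw [norm_div_phi0Denom _ _ hne]
  calc _ ≤ (1 + R) * w * Real.exp (-(k * R)) / (a * w * (b * w ^ 2 / 2)) := by
        simp only [add_im, ofReal_im, mul_im, ofReal_re, I_im, mul_one, I_re, mul_zero, add_zero,
          zero_add]
        gcongr
    _ = _ := by rw [← hw2]; field_simp

lemma exists_height {ω : ℝ} (hω0 : 0 < ω) (hω1 : ω < 1) :
    ∃ c > 0, ∃ L : ℝ, ∀ X : ℝ, 0 ≤ X → ∃ R, X ≤ R ∧ R ≤ X + L ∧
      c ≤ |Real.sin (ω * R)| ∧ c ≤ |Real.cos ((1 - ω) * R)| := by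
  have hπ := pi_pos
  set d := Real.sin ((1 - ω) * (π / 4)) with hd
  have hd0 : 0 < d := Real.sin_pos_of_pos_of_lt_pi (by nlinarith) (by nlinarith)
  have hd1 : d ≤ 1 := Real.sin_le_one _
  refine ⟨d / 4, by positivity, 2 * π / ω + π / 4, fun X hX => ?_⟩
  set q := ⌈X * ω / π⌉₊ with hq
  have hq1 := Nat.le_ceil (X * ω / π)
  have hq2 := (Nat.ceil_lt_add_one (a := X * ω / π) (by positivity)).le
  rw [div_le_iff₀ hπ] at hq1
  set R := (q + 1 / 2) * π / ω with hR
  have hR1 : X ≤ R := by rw [hR, le_div_iff₀ hω0]; nlinarith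
  have hR2 : R ≤ X + 2 * π / ω := by
    rw [hR, div_le_iff₀ hω0, add_mul X, div_mul_cancel₀ _ hω0.ne']
    have : (q : ℝ) * π ≤ (X * ω / π + 1) * π := by gcongr
    rw [add_mul, div_mul_cancel₀ _ hπ.ne'] at this
    linarith
  have hωR : ω * R = q * π + π / 2 := by rw [hR]; field_simp
  have hcosR : Real.cos (ω * R) = 0 := by
    rw [hωR, Real.cos_add_pi_div_two, Real.sin_nat_mul_pi, neg_zero]
  have hsinR : |Real.sin (ω * R)| = 1 := by
    have := Real.sin_sq_add_cos_sq (ω * R)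
    rw [hcosR] at this
    rw [← abs_one, ← sq_eq_sq_iff_abs_eq_abs]
    linarith
  by_cases hgood : d / 4 ≤ |Real.cos ((1 - ω) * R)|
  · exact ⟨R, hR1, by linarith, by rw [hsinR]; linarith, hgood⟩
  · push Not at hgood
    refine ⟨R + π / 4, by linarith, by linarith, ?_, ?_⟩
    · rw [mul_add, Real.sin_add, hcosR, zero_mul, add_zero, abs_mul, hsinR, one_mul]
      have h1 : Real.cos (π / 4) ≤ Real.cos (ω * (π / 4)) :=
        Real.cos_le_cos_of_nonneg_of_le_pi (by positivity) (by linarith) (by nlinarith)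
      have h2 : (1 : ℝ) / 2 ≤ Real.cos (π / 4) := by
        rw [← Real.cos_pi_div_three]
        exact Real.cos_le_cos_of_nonneg_of_le_pi (by positivity) (by linarith) (by linarith)
      exact le_trans (by linarith) (le_abs_self _)
    · rw [mul_add, Real.cos_add, ← hd]
      set x := (1 - ω) * R
      have hsx : 1 / 2 ≤ |Real.sin x| := by
        refine le_of_sq_le_sq ?_ (abs_nonneg _)
        have := Real.sin_sq_add_cos_sq x
        rw [sq_abs]
        have h3 : Real.cos x ^ 2 ≤ (1 / 4) ^ 2 := by
          rw [← sq_abs]; gcongr; linarith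
        linarith
      have h4 := abs_sub_abs_le_abs_sub (Real.sin x * d) (Real.cos x * Real.cos ((1 - ω) * (π / 4)))
      rw [abs_sub_comm, abs_mul, abs_mul, abs_of_pos hd0] at h4
      have h5 : |Real.cos x| * |Real.cos ((1 - ω) * (π / 4))| ≤ d / 4 * 1 :=
        mul_le_mul hgood.le (Real.abs_cos_le_one _) (abs_nonneg _) (by positivity)
      nlinarith

/-- The term of the residue series at the pole `i (n+1) π / ω`. -/
noncomputable def sinhPoleTerm (ω k : ℝ) (n : ℕ) : ℝ :=
  (-1) ^ n * ((n + 1) * Real.exp (-((n + 1) * π / ω * k)) /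
    (ω ^ 2 * Real.cos ((1 - ω) * ((n + 1) * π / ω))))

/-- The term of the residue series at the pole `i (n+1/2) π / (1-ω)`. -/
noncomputable def coshPoleTerm (ω k : ℝ) (n : ℕ) : ℝ :=
  (-1) ^ n * ((n + 1 / 2) * Real.exp (-((n + 1 / 2) * π / (1 - ω) * k)) /
    ((1 - ω) ^ 2 * Real.sin (ω * ((n + 1 / 2) * π / (1 - ω)))))

lemma tendsto_sub_mul_div_phi0Denom {ω k : ℝ} {p D : ℂ} (hp : p ≠ 0)
    (h0 : Complex.sinh (ω * p) * Complex.cosh ((1 - ω) * p) = 0)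
    (hD : HasDerivAt (fun z : ℂ => Complex.sinh (ω * z) * Complex.cosh ((1 - ω) * z)) D p)
    (hD0 : D ≠ 0) :
    Tendsto (fun z => (z - p) * (cexp (I * k * z) / phi0Denom ω z)) (𝓝[≠] p)
      (𝓝 (p * cexp (I * k * p) / D)) := by
  have h1 := (hasDerivAt_iff_tendsto_slope.1 hD).inv₀ hD0
  have h2 : Tendsto (fun z : ℂ => z * cexp (I * k * z)) (𝓝[≠] p) (𝓝 (p * cexp (I * k * p))) :=
    (Continuous.tendsto (by fun_prop) p).mono_left nhdsWithin_le_nhds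
  rw [div_eq_mul_inv]
  refine (h2.mul h1).congr' ?_
  filter_upwards [mem_nhdsWithin_of_mem_nhds (isOpen_ne.mem_nhds hp)] with z hz
  rw [phi0Denom_of_ne _ hz, slope_def_field, h0, sub_zero, inv_div, div_div_eq_mul_div]
  ring

lemma hasDerivAt_sinh_mul_cosh (ω y : ℝ) :
    HasDerivAt (fun z : ℂ => Complex.sinh (ω * z) * Complex.cosh ((1 - ω) * z))
      ((ω * Real.cos (ω * y) * Real.cos ((1 - ω) * y) -
        (1 - ω) * Real.sin (ω * y) * Real.sin ((1 - ω) * y) : ℝ) : ℂ) (y * I) := by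
  have h1 := ((hasDerivAt_id (y * I : ℂ)).const_mul (ω : ℂ)).csinh.mul
    ((hasDerivAt_id (y * I : ℂ)).const_mul (1 - ω : ℂ)).ccosh
  convert! h1 using 1
  simp only [id, ← mul_assoc, Complex.sinh_mul_I, Complex.cosh_mul_I]
  push_cast
  linear_combination (-(1 - (ω : ℂ)) * Complex.sin (ω * y) * Complex.sin ((1 - ω) * y)) * I_sq

lemma tendsto_sub_mul_div_phi0Denom_mul_I {ω k y : ℝ} (hy : y ≠ 0)
    (h0 : Real.sin (ω * y) * Real.cos ((1 - ω) * y) = 0) {D c : ℝ}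
    (hD : ω * Real.cos (ω * y) * Real.cos ((1 - ω) * y) -
        (1 - ω) * Real.sin (ω * y) * Real.sin ((1 - ω) * y) = D) (hD0 : D ≠ 0)
    (hc : -(y * Real.exp (-(y * k))) / D = π * c) :
    Tendsto (fun z => (z - y * I) * (cexp (I * k * z) / phi0Denom ω z)) (𝓝[≠] (y * I))
      (𝓝 (-(π * I) * (c : ℂ))) := by
  have hp : (y * I : ℂ) ≠ 0 := by simpa using hy
  have := tendsto_sub_mul_div_phi0Denom (k := k) hp ?_ (hD ▸ hasDerivAt_sinh_mul_cosh ω y)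
    (by exact_mod_cast hD0)
  · convert this using 2
    have he : I * k * (y * I) = ((-(y * k) : ℝ) : ℂ) := by
      push_cast
      linear_combination (k * y : ℂ) * I_sq
    rw [he, ← ofReal_exp]
    have hc' := congrArg ((↑) : ℝ → ℂ) hc
    push_cast at hc' ⊢
    linear_combination I * hc'
  · have := congrArg ((↑) : ℝ → ℂ) h0
    push_cast at this
    rw [← mul_assoc, ← mul_assoc, Complex.sinh_mul_I, Complex.cosh_mul_I]
    linear_combination I * this

lemma tendsto_at_sinhPole {ω : ℝ} (hω0 : 0 < ω) (k : ℝ) (n : ℕ)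
    (h : Real.cos ((1 - ω) * ((n + 1) * π / ω)) ≠ 0) :
    Tendsto (fun z => (z - ((n + 1) * π / ω : ℝ) * I) * (cexp (I * k * z) / phi0Denom ω z))
      (𝓝[≠] (((n + 1) * π / ω : ℝ) * I)) (𝓝 (-(π * I) * (sinhPoleTerm ω k n : ℂ))) := by
  have hωy : ω * ((n + 1) * π / ω) = (n + 1 : ℕ) * π := by push_cast; field_simp
  have hs : Real.sin (ω * ((n + 1) * π / ω)) = 0 := by rw [hωy, Real.sin_nat_mul_pi]
  have hc : Real.cos (ω * ((n + 1) * π / ω)) = -(-1) ^ n := by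
    rw [hωy, Real.cos_nat_mul_pi, pow_succ]; ring
  refine tendsto_sub_mul_div_phi0Denom_mul_I (by positivity) (by rw [hs, zero_mul]) rfl ?_ ?_
  · rw [hs, hc]
    simp [hω0.ne', h]
  · rw [hs, hc, sinhPoleTerm]
    generalize Real.cos ((1 - ω) * ((n + 1) * π / ω)) = u at h ⊢
    generalize Real.exp _ = v
    rcases neg_one_pow_eq_or ℝ n with h1 | h1 <;> rw [h1] <;> field_simp <;> ring

lemma tendsto_at_coshPole {ω : ℝ} (hω1 : ω < 1) (k : ℝ) (n : ℕ)
    (h : Real.sin (ω * ((n + 1 / 2) * π / (1 - ω))) ≠ 0) :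
    Tendsto
      (fun z => (z - ((n + 1 / 2) * π / (1 - ω) : ℝ) * I) * (cexp (I * k * z) / phi0Denom ω z))
      (𝓝[≠] (((n + 1 / 2) * π / (1 - ω) : ℝ) * I))
      (𝓝 (-(π * I) * (coshPoleTerm ω k n : ℂ))) := by
  have hω1' : 0 < 1 - ω := by linarith
  have hωy : (1 - ω) * ((n + 1 / 2) * π / (1 - ω)) = n * π + π / 2 := by field_simp
  have hc : Real.cos ((1 - ω) * ((n + 1 / 2) * π / (1 - ω))) = 0 := by
    rw [hωy, Real.cos_add_pi_div_two, Real.sin_nat_mul_pi, neg_zero]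
  have hs : Real.sin ((1 - ω) * ((n + 1 / 2) * π / (1 - ω))) = (-1) ^ n := by
    rw [hωy, Real.sin_add_pi_div_two, Real.cos_nat_mul_pi]
  refine tendsto_sub_mul_div_phi0Denom_mul_I (by positivity) (by rw [hc, mul_zero]) rfl ?_ ?_
  · rw [hs, hc]
    rw [mul_zero, zero_sub]
    exact neg_ne_zero.2 (mul_ne_zero (mul_ne_zero hω1'.ne' h) (pow_ne_zero _ (by norm_num)))
  · rw [hs, hc, coshPoleTerm]
    have := hω1'.ne'
    generalize Real.sin (ω * ((n + 1 / 2) * π / (1 - ω))) = u at h ⊢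
    generalize Real.exp _ = v
    generalize 1 - ω = t at this ⊢
    rcases neg_one_pow_eq_or ℝ n with h1 | h1 <;> rw [h1] <;> field_simp <;> ring

/-- Truncating the residue series at a suitable height `R`. -/
lemma exists_norm_integral_sub_sum_le {ω : ℝ} (hω0 : 0 < ω) (hω1 : ω < 1)
    (hcos : ∀ n : ℕ, Real.cos ((1 - ω) * ((n + 1) * π / ω)) ≠ 0)
    (hsin : ∀ n : ℕ, Real.sin (ω * ((n + 1 / 2) * π / (1 - ω))) ≠ 0) {k : ℝ} (hk : 0 < k) :
    ∃ K L : ℝ, ∀ X : ℝ, 0 < X → ∃ R, X ≤ R ∧ R ≤ X + L ∧ ∀ M : ℕ, R ≤ M →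
      ‖(∫ t : ℝ, (phi0 ω t : ℂ) * cexp (I * k * t)) -
        ((2 * π ^ 2 * ((∑ i ∈ Finset.range M with ((i : ℕ) + 1 : ℝ) * π / ω < R, sinhPoleTerm ω k i) +
          ∑ j ∈ Finset.range M with ((j : ℕ) + 1 / 2 : ℝ) * π / (1 - ω) < R, coshPoleTerm ω k j) : ℝ) :
          ℂ)‖ ≤ K * ((1 + R) * Real.exp (-(k * R))) := by
  have hω1' : 0 < 1 - ω := by linarith
  have hπ := pi_gt_three
  obtain ⟨c, hc0, L, hL⟩ := exists_height hω0 hω1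
  obtain ⟨K, hK⟩ := norm_div_phi0Denom_le_of_height (k := k) hω0 hω1 hc0
  refine ⟨K * π, L, fun X hX => ?_⟩
  obtain ⟨R, hXR, hRX, hs, hc⟩ := hL X hX.le
  refine ⟨R, hXR, hRX, fun M hM => ?_⟩
  have hR : 0 < R := hX.trans_le hXR
  set y : ℕ ⊕ ℕ → ℝ := Sum.elim (fun i => (i + 1) * π / ω) (fun j => (j + 1 / 2) * π / (1 - ω))
    with hy
  set coeff : ℕ ⊕ ℕ → ℂ := Sum.elim (fun i => -(π * I) * (sinhPoleTerm ω k i : ℂ))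
    (fun j => -(π * I) * (coshPoleTerm ω k j : ℂ)) with hcoeff
  set s : Finset (ℕ ⊕ ℕ) := ({i ∈ Finset.range M | ((i : ℕ) + 1 : ℝ) * π / ω < R}).disjSum
    {j ∈ Finset.range M | ((j : ℕ) + 1 / 2 : ℝ) * π / (1 - ω) < R} with hs_def
  have hmem : ∀ σ, σ ∈ s ↔ y σ < R := by
    rintro (i | j)
    · simp only [hs_def, hy, Finset.inl_mem_disjSum, Finset.mem_filter, Finset.mem_range,
        Sum.elim_inl, and_iff_right_iff_imp]
      intro h
      rw [div_lt_iff₀ hω0] at h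
      have : (i : ℝ) < M := by nlinarith
      exact_mod_cast this
    · simp only [hs_def, hy, Finset.inr_mem_disjSum, Finset.mem_filter, Finset.mem_range,
        Sum.elim_inr, and_iff_right_iff_imp]
      intro h
      rw [div_lt_iff₀ hω1'] at h
      have : (j : ℝ) < M := by nlinarith
      exact_mod_cast this
  have hsin_inl : ∀ i : ℕ, Real.sin (ω * y (.inl i)) = 0 := fun i => by
    rw [← Real.sin_nat_mul_pi (i + 1)]
    simp only [hy, Sum.elim_inl]
    congr 1
    push_cast
    field_simp
  have hcos_inr : ∀ j : ℕ, Real.cos ((1 - ω) * y (.inr j)) = 0 := fun j => by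
    rw [← neg_zero, ← Real.sin_nat_mul_pi j, ← Real.cos_add_pi_div_two]
    simp only [hy, Sum.elim_inr]
    congr 1
    field_simp
  have hinj : Function.Injective y := by
    rintro (i | i) (j | j) hij
    · simpa [hy, hω0.ne', pi_ne_zero] using hij
    · exact absurd (hij.symm ▸ hcos_inr j : Real.cos ((1 - ω) * y (.inl i)) = 0) (hcos i)
    · exact absurd (hij ▸ hcos_inr i : Real.cos ((1 - ω) * y (.inl j)) = 0) (hcos j)
    · simpa [hy, hω1'.ne', pi_ne_zero] using hij
  have hypos : ∀ σ, 0 < y σ := by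
    rintro (i | j) <;> simp only [hy, Sum.elim_inl, Sum.elim_inr] <;> positivity
  have hyR : ∀ σ, y σ ≠ R := by
    rintro (i | j) rfl
    · rw [hsin_inl, abs_zero] at hs
      linarith
    · rw [hcos_inr, abs_zero] at hc
      linarith
  have key := integral_sub_integral_add_mul_I_eq_sum hR y coeff s
    (fun z => cexp (I * k * z) / phi0Denom ω z) _ hinj.injOn
    (fun σ hσ => ⟨hypos σ, (hmem σ).1 hσ⟩) ?_ ?_
    (fun z h0 h1 h2 => norm_div_phi0Denom_le hω0 hω1 hk h0 h1 h2)
  · have hJ : ∫ t : ℝ, (phi0 ω t : ℂ) * cexp (I * k * t) =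
        ∫ x : ℝ, cexp (I * k * x) / phi0Denom ω x := by
      simp_rw [ofReal_phi0, div_eq_inv_mul]
    have hsum : 2 * π * I * ∑ σ ∈ s, coeff σ =
        ((2 * π ^ 2 * ((∑ i ∈ Finset.range M with ((i : ℕ) + 1 : ℝ) * π / ω < R, sinhPoleTerm ω k i) +
          ∑ j ∈ Finset.range M with ((j : ℕ) + 1 / 2 : ℝ) * π / (1 - ω) < R, coshPoleTerm ω k j) : ℝ) :
          ℂ) := by
      rw [hs_def, Finset.sum_disjSum]
      simp only [hcoeff, Sum.elim_inl, Sum.elim_inr, ← Finset.mul_sum]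
      push_cast
      linear_combination (-2 * π ^ 2 * ((∑ i ∈ Finset.range M with ((i : ℕ) + 1 : ℝ) * π / ω < R,
        (sinhPoleTerm ω k i : ℂ)) + ∑ j ∈ Finset.range M with ((j : ℕ) + 1 / 2 : ℝ) * π / (1 - ω) < R,
        (coshPoleTerm ω k j : ℂ))) * I_sq
    rw [hJ, ← hsum, ← key, sub_sub_cancel]
    refine (norm_integral_le_of_norm_le (integrable_inv_one_add_sq.const_mul _)
      (Eventually.of_forall (hK R hR hs hc))).trans_eq ?_
    rw [integral_const_mul, integral_univ_inv_one_add_sq]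
    ring
  · intro z h0 h1 hz
    have hz' : ∀ σ, z ≠ y σ * I := by
      intro σ hzσ
      refine hz σ ((hmem σ).2 (lt_of_le_of_ne ?_ (hyR σ))) hzσ
      simpa [hzσ] using h1
    exact DifferentiableAt.fun_div (by fun_prop) (differentiable_phi0Denom ω z)
      (phi0Denom_ne_zero hω0 hω1 h0 (fun i => hz' (.inl i)) (fun j => hz' (.inr j)))
  · rintro (i | j) -
    · exact tendsto_at_sinhPole hω0 k i (hcos i)
    · exact tendsto_at_coshPole hω1 k j (hsin j)

/-- If the forms `2n(1-ω) - (2j+1)ω` never vanish, there are infinitely many scales `T` at which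
none of those with `n + j ≤ C T` is exponentially small: otherwise the exponentially good rational
approximations to `(1-ω)/ω` at consecutive scales would all coincide. -/
lemma exists_exp_neg_le_abs_linear_form {ω : ℝ} (hω0 : 0 < ω)
    (hθ : ∀ n j : ℕ, 2 * (n : ℝ) * (1 - ω) - (2 * j + 1) * ω ≠ 0) {δ : ℝ} (hδ : 0 < δ) (C : ℝ)
    (N : ℕ) : ∃ T : ℕ, N ≤ T ∧ ∀ n j : ℕ, (n : ℝ) + j ≤ C * T →
      Real.exp (-(δ * T)) ≤ |2 * (n : ℝ) * (1 - ω) - (2 * j + 1) * ω| := by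
  by_contra! hcon
  choose! n j hC hlt using hcon
  have hexp : Tendsto (fun T : ℕ => Real.exp (-(δ * T))) atTop (𝓝 0) :=
    Real.tendsto_exp_neg_atTop_nhds_zero.comp (tendsto_natCast_atTop_atTop.const_mul_atTop hδ)
  have hsmall : Tendsto (fun T : ℕ => 2 * |C| * ((T + 1) * Real.exp (-(δ * T)))) atTop (𝓝 0) := by
    have h1 := (Real.tendsto_pow_mul_exp_neg_atTop_nhds_zero 1).comp
      (tendsto_natCast_atTop_atTop.const_mul_atTop hδ)
    have h2 := ((h1.const_mul δ⁻¹).add hexp).const_mul (2 * |C|)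
    simp only [mul_zero, add_zero] at h2
    refine h2.congr fun T => ?_
    simp only [Function.comp_apply, pow_one]
    field_simp
  obtain ⟨N₁, hN₁⟩ := eventually_atTop.1 (hsmall.eventually_lt_const hω0)
  have hcross : ∀ T, N ≤ T → N₁ ≤ T →
      (n T : ℤ) * (2 * j (T + 1) + 1) - n (T + 1) * (2 * j T + 1) = 0 := by
    intro T hT hT₁
    rw [← Int.abs_lt_one_iff]
    have h0 := hlt T hT
    have h1 := hlt (T + 1) (by omega)
    have hle : Real.exp (-(δ * (T + 1 : ℕ))) ≤ Real.exp (-(δ * T)) := by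
      gcongr; linarith
    have hn : ∀ S, N ≤ S → S ≤ T + 1 → (n S : ℝ) ≤ |C| * (T + 1) := by
      intro S hS hST
      have hST' : (S : ℝ) ≤ T + 1 := by exact_mod_cast hST
      calc (n S : ℝ) ≤ C * S := by linarith [hC S hS, (j S).cast_nonneg (α := ℝ)]
        _ ≤ |C| * (T + 1) := by gcongr; exact le_abs_self C
    have key : ω * |((n T : ℝ) * (2 * j (T + 1) + 1) - n (T + 1) * (2 * j T + 1))| < ω * 1 := by
      rw [← abs_of_pos hω0, ← abs_mul, abs_of_pos hω0, mul_one]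
      calc _ = |n (T + 1) * (2 * (n T : ℝ) * (1 - ω) - (2 * j T + 1) * ω) -
            n T * (2 * (n (T + 1) : ℝ) * (1 - ω) - (2 * j (T + 1) + 1) * ω)| := by
              congr 1; ring
        _ ≤ n (T + 1) * |2 * (n T : ℝ) * (1 - ω) - (2 * j T + 1) * ω| +
            n T * |2 * (n (T + 1) : ℝ) * (1 - ω) - (2 * j (T + 1) + 1) * ω| := by
              refine (abs_sub _ _).trans_eq ?_
              rw [abs_mul, abs_mul, Nat.abs_cast, Nat.abs_cast]
        _ ≤ |C| * (T + 1) * Real.exp (-(δ * T)) + |C| * (T + 1) * Real.exp (-(δ * T)) := by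
              gcongr
              exacts [hn _ (by omega) le_rfl, hn _ hT (by omega), h1.le.trans hle]
        _ < ω := by linarith [hN₁ T hT₁]
    have := lt_of_mul_lt_mul_left key hω0.le
    exact_mod_cast this
  set N₂ := max N N₁
  have hconst : ∀ T, N₂ ≤ T → (n T : ℝ) / (2 * j T + 1) = n N₂ / (2 * j N₂ + 1) := by
    intro T hT
    induction T, hT using Nat.le_induction with
    | base => rfl
    | succ T hT ih =>
      rw [← ih, div_eq_div_iff (by positivity) (by positivity)]
      have := hcross T ((le_max_left _ _).trans hT) ((le_max_right _ _).trans hT)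
      have : (n T : ℝ) * (2 * j (T + 1) + 1) - n (T + 1) * (2 * j T + 1) = 0 := by
        exact_mod_cast this
      linarith
  set κ := 2 * ((n N₂ : ℝ) / (2 * j N₂ + 1)) * (1 - ω) - ω with hκ
  have hκT : ∀ T, N₂ ≤ T → |κ| ≤ Real.exp (-(δ * T)) := by
    intro T hT
    have h0 := hlt T ((le_max_left _ _).trans hT)
    have h1 : 2 * (n T : ℝ) * (1 - ω) - (2 * j T + 1) * ω = (2 * j T + 1) * κ := by
      rw [hκ, ← hconst T hT]; field_simp
    rw [h1, abs_mul, abs_of_pos (by positivity)] at h0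
    nlinarith [abs_nonneg κ, (j T).cast_nonneg (α := ℝ),
      mul_nonneg (j T).cast_nonneg (α := ℝ) (abs_nonneg κ)]
  have hκ0 : |κ| ≤ 0 := ge_of_tendsto hexp (eventually_atTop.2 ⟨N₂, hκT⟩)
  refine hθ (n N₂) (j N₂) ?_
  have : κ = 0 := abs_nonpos_iff.1 hκ0
  rw [hκ] at this
  field_simp at this
  linarith

lemma two_mul_abs_le_abs_sin_pi_mul {x : ℝ} (hx : |x| ≤ 1 / 2) : 2 * |x| ≤ |Real.sin (x * π)| := by
  have hπ := pi_pos
  have h := Real.mul_abs_le_abs_sin (x := x * π) (by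
    rw [abs_mul, abs_of_pos hπ]; nlinarith)
  rw [abs_mul, abs_of_pos hπ] at h
  convert h using 1
  field_simp

lemma exists_abs_linear_form_le_abs_cos {ω : ℝ} (hω0 : 0 < ω) (hω1 : ω < 1) (n : ℕ) :
    ∃ j : ℕ, (n : ℝ) + j ≤ n / ω ∧
      |2 * (n : ℝ) * (1 - ω) - (2 * j + 1) * ω| ≤ |Real.cos ((1 - ω) * (n * π / ω))| := by
  have hω1' : 0 < 1 - ω := by linarith
  set u := n * (1 - ω) / ω with hu
  have hu0 : 0 ≤ u := by positivity
  have h1 := Nat.floor_le hu0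
  have h2 := Nat.lt_floor_add_one u
  refine ⟨⌊u⌋₊, ?_, ?_⟩
  · have : (n : ℝ) / ω = n + u := by rw [hu]; field_simp; ring
    linarith
  · set x := u - ⌊u⌋₊ - 1 / 2 with hx
    have hxx : |x| ≤ 1 / 2 := abs_le.2 ⟨by linarith, by linarith⟩
    have harg : (1 - ω) * (n * π / ω) = x * π + π / 2 + ⌊u⌋₊ * π := by
      rw [hx, hu]; ring
    have hθ : 2 * (n : ℝ) * (1 - ω) - (2 * ⌊u⌋₊ + 1) * ω = ω * (2 * x) := by
      have : u * ω = n * (1 - ω) := by rw [hu]; field_simp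
      rw [hx]; linarith
    rw [harg, Real.cos_add_nat_mul_pi, abs_mul, abs_pow, abs_neg, abs_one, one_pow, one_mul,
      Real.cos_add_pi_div_two, abs_neg, hθ, abs_mul, abs_mul, abs_of_pos hω0, abs_two]
    have := two_mul_abs_le_abs_sin_pi_mul hxx
    nlinarith [abs_nonneg x]

lemma exists_abs_linear_form_le_abs_sin {ω : ℝ} (hω0 : 0 < ω) (hω1 : ω < 1) (j : ℕ) :
    ∃ n : ℕ, (n : ℝ) + j ≤ (j + 1) / (1 - ω) ∧
      |2 * (n : ℝ) * (1 - ω) - (2 * j + 1) * ω| ≤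
        |Real.sin (ω * ((j + 1 / 2) * π / (1 - ω)))| := by
  have hω1' : 0 < 1 - ω := by linarith
  set u := (j + 1 / 2) * ω / (1 - ω) with hu
  have hu0 : 0 ≤ u := by positivity
  have h1 := Nat.floor_le (show 0 ≤ u + 1 / 2 by positivity)
  have h2 := Nat.lt_floor_add_one (u + 1 / 2)
  set n := ⌊u + 1 / 2⌋₊
  refine ⟨n, ?_, ?_⟩
  · have h3 : ((j : ℝ) + 1 / 2) / (1 - ω) = j + 1 / 2 + u := by rw [hu]; field_simp; ring
    have h4 : ((j : ℝ) + 1 / 2) / (1 - ω) ≤ (j + 1) / (1 - ω) := by gcongr; norm_num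
    linarith
  · set x := u - n with hx
    have hxx : |x| ≤ 1 / 2 := abs_le.2 ⟨by linarith, by linarith⟩
    have harg : ω * ((j + 1 / 2) * π / (1 - ω)) = x * π + n * π := by
      rw [hx, hu]; ring
    have hθ : 2 * (n : ℝ) * (1 - ω) - (2 * j + 1) * ω = -((1 - ω) * (2 * x)) := by
      have : u * (1 - ω) = (j + 1 / 2) * ω := by rw [hu]; field_simp
      rw [hx]; linarith
    rw [harg, Real.sin_add_nat_mul_pi, abs_mul, abs_pow, abs_neg, abs_one, one_pow, one_mul,
      hθ, abs_neg, abs_mul, abs_mul, abs_of_pos hω1', abs_two]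
    have := two_mul_abs_le_abs_sin_pi_mul hxx
    nlinarith [abs_nonneg x]

lemma abs_sum_sub_sum_filter_lt_le {a h : ℕ → ℝ} {R B : ℝ} {M : ℕ}
    (hB : ∀ i < M, R ≤ h i → |a i| ≤ B) :
    |∑ i ∈ Finset.range M, a i - ∑ i ∈ Finset.range M with h i < R, a i| ≤ M * |B| := by
  rw [← Finset.sum_filter_add_sum_filter_not (Finset.range M) (fun i => h i < R),
    add_sub_cancel_left]
  refine (Finset.abs_sum_le_sum_abs _ _).trans ?_
  refine (Finset.sum_le_card_nsmul _ _ |B| fun i hi => ?_).trans ?_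
  · rw [Finset.mem_filter, Finset.mem_range, not_lt] at hi
    exact (hB i hi.1 hi.2).trans (le_abs_self B)
  · rw [nsmul_eq_mul]
    gcongr
    exact (Finset.card_filter_le _ _).trans_eq (Finset.card_range M)

lemma exists_norm_integral_sub_sum_range_le {ω : ℝ} (hω0 : 0 < ω) (hω1 : ω < 1)
    (hcos : ∀ n : ℕ, Real.cos ((1 - ω) * ((n + 1) * π / ω)) ≠ 0)
    (hsin : ∀ n : ℕ, Real.sin (ω * ((n + 1 / 2) * π / (1 - ω))) ≠ 0) {k : ℝ} (hk : 0 < k)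
    {ε : ℝ} (hε : 0 < ε) (N : ℕ) : ∃ M, N ≤ M ∧
      ‖(∫ t : ℝ, (phi0 ω t : ℂ) * cexp (I * k * t)) -
        ((2 * π ^ 2 * ∑ i ∈ Finset.range M, (sinhPoleTerm ω k i + coshPoleTerm ω k i) : ℝ) : ℂ)‖
        ≤ ε := by
  have hω1' : 0 < 1 - ω := by linarith
  have hπ := pi_gt_three
  have hθ : ∀ n j : ℕ, 2 * (n : ℝ) * (1 - ω) - (2 * j + 1) * ω ≠ 0 := by
    intro n j h
    refine hsin j ?_
    have : ω * ((j + 1 / 2) * π / (1 - ω)) = n * π := by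
      field_simp
      linear_combination (-1 : ℝ) * h
    rw [this, Real.sin_nat_mul_pi]
  obtain ⟨K, L, hKL⟩ := exists_norm_integral_sub_sum_le hω0 hω1 hcos hsin hk
  set m := ω * (1 - ω) with hm
  have hm0 : 0 < m := mul_pos hω0 hω1'
  have hm1 : m ≤ 1 := by nlinarith
  have hmω : m ≤ ω := by nlinarith
  have hmω' : m ≤ 1 - ω := by nlinarith
  set C := π / m + |L| + 1 with hC
  have hC0 : 0 < C := by positivity
  set H := |K| * (1 + C) + 4 * π ^ 2 * C ^ 2 / m ^ 2 with hH
  have hlim : Tendsto (fun T : ℕ => H * ((T : ℝ) ^ 2 * Real.exp (-(k / 2 * T)))) atTop (𝓝 0) := by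
    have h1 := (Real.tendsto_pow_mul_exp_neg_atTop_nhds_zero 2).comp
      (tendsto_natCast_atTop_atTop.const_mul_atTop (half_pos hk))
    have h2 := h1.const_mul (H * ((k / 2) ^ 2)⁻¹)
    rw [mul_zero] at h2
    refine h2.congr fun T => ?_
    simp only [Function.comp_apply, mul_pow]
    field_simp
  obtain ⟨N₁, hN₁⟩ := eventually_atTop.1 (hlim.eventually_le_const hε)
  obtain ⟨T, hTN, hT⟩ := exists_exp_neg_le_abs_linear_form hω0 hθ (half_pos hk) (C / m)
    (max (max N N₁) 1)
  have hT1 : (1 : ℝ) ≤ T := by exact_mod_cast (le_max_right _ _).trans hTN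
  have hNT : N ≤ T := (le_max_left _ _).trans ((le_max_left _ _).trans hTN)
  have hN₁T : N₁ ≤ T := (le_max_right _ _).trans ((le_max_left _ _).trans hTN)
  obtain ⟨R, hXR, hRX, hR⟩ := hKL (T * π / m) (by positivity)
  have hTR : (T : ℝ) ≤ R := by
    refine le_trans ?_ hXR
    rw [le_div_iff₀ hm0]
    nlinarith
  have hRM := Nat.le_ceil R
  have hMC : (⌈R⌉₊ : ℝ) ≤ C * T := by
    have h1 := (Nat.ceil_lt_add_one (show 0 ≤ R by linarith)).le
    have h2 : |L| ≤ |L| * T := le_mul_of_one_le_right (abs_nonneg L) hT1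
    have h3 := le_abs_self L
    have h4 : C * T = T * π / m + |L| * T + T := by rw [hC]; ring
    linarith
  have hRC : R ≤ C * T := hRM.trans hMC
  set M := ⌈R⌉₊ with hM
  set η := Real.exp (-(k / 2 * T)) with hη
  have hη0 : 0 < η := Real.exp_pos _
  have hηη : ∀ h : ℝ, R ≤ h → Real.exp (-(h * k)) ≤ η * η := by
    intro h hh
    rw [hη, ← Real.exp_add]
    gcongr
    nlinarith
  have hA : ∀ i < M, R ≤ ((i : ℕ) + 1 : ℝ) * π / ω →
      |sinhPoleTerm ω k i| ≤ C * T * η / m ^ 2 := by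
    intro i hi hRi
    have hiM : (i : ℝ) + 1 ≤ M := by exact_mod_cast hi
    obtain ⟨j, hj, hle⟩ := exists_abs_linear_form_le_abs_cos hω0 hω1 (i + 1)
    have hgood := (hT (i + 1) j (hj.trans ?_)).trans hle
    · push_cast at hgood
      rw [sinhPoleTerm, abs_mul, abs_neg_one_pow, one_mul, abs_div, abs_mul, abs_mul,
        Real.abs_exp, abs_of_nonneg (by positivity : (0 : ℝ) ≤ i + 1), abs_of_pos (pow_pos hω0 2)]
      calc _ ≤ C * T * (η * η) / (m ^ 2 * η) := by
            have := hηη _ hRi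
            gcongr
            linarith
        _ = _ := by field_simp
    · push_cast
      calc ((i : ℝ) + 1) / ω ≤ C * T / m := by gcongr; linarith
        _ = C / m * T := by ring
  have hB : ∀ j < M, R ≤ ((j : ℕ) + 1 / 2 : ℝ) * π / (1 - ω) →
      |coshPoleTerm ω k j| ≤ C * T * η / m ^ 2 := by
    intro j hj hRj
    have hjM : (j : ℝ) + 1 ≤ M := by exact_mod_cast hj
    obtain ⟨n, hn, hle⟩ := exists_abs_linear_form_le_abs_sin hω0 hω1 j
    have hgood := (hT n j (hn.trans ?_)).trans hle
    · rw [coshPoleTerm, abs_mul, abs_neg_one_pow, one_mul, abs_div, abs_mul, abs_mul,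
        Real.abs_exp, abs_of_nonneg (by positivity : (0 : ℝ) ≤ j + 1 / 2),
        abs_of_pos (pow_pos hω1' 2)]
      calc _ ≤ C * T * (η * η) / (m ^ 2 * η) := by
            have := hηη _ hRj
            gcongr
            linarith
        _ = _ := by field_simp
    · calc ((j : ℝ) + 1) / (1 - ω) ≤ C * T / m := by gcongr; linarith
        _ = C / m * T := by ring
  refine ⟨M, ?_, ?_⟩
  · exact_mod_cast ((by exact_mod_cast hNT : (N : ℝ) ≤ T).trans (hTR.trans hRM))
  · have hA' := abs_sum_sub_sum_filter_lt_le hA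
    have hB' := abs_sum_sub_sum_filter_lt_le hB
    have hbound : (M : ℝ) * |C * T * η / m ^ 2| ≤ C ^ 2 / m ^ 2 * (T ^ 2 * η) := by
      rw [abs_of_nonneg (by positivity)]
      calc _ ≤ C * T * (C * T * η / m ^ 2) := by gcongr
        _ = _ := by ring
    have hmain := hR M hRM
    have hexp : Real.exp (-(k * R)) ≤ η := by
      rw [hη]
      gcongr
      nlinarith
    have htail : K * ((1 + R) * Real.exp (-(k * R))) ≤ |K| * (1 + C) * (T ^ 2 * η) := by
      have hR0 : 0 ≤ R := by linarith
      have hTT : (T : ℝ) ≤ T ^ 2 := le_self_pow₀ hT1 two_ne_zero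
      have hRT : 1 + R ≤ T ^ 2 + C * T ^ 2 :=
        add_le_add (hT1.trans hTT) (hRC.trans (mul_le_mul_of_nonneg_left hTT hC0.le))
      calc _ ≤ |K| * ((1 + R) * Real.exp (-(k * R))) :=
            mul_le_mul_of_nonneg_right (le_abs_self K) (by positivity)
        _ ≤ |K| * ((T ^ 2 + C * T ^ 2) * η) := mul_le_mul_of_nonneg_left
            (mul_le_mul hRT hexp (Real.exp_pos _).le (by positivity)) (abs_nonneg K)
        _ = _ := by ring
    set A' := ∑ i ∈ Finset.range M with ((i : ℕ) + 1 : ℝ) * π / ω < R, sinhPoleTerm ω k i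
    set B' := ∑ j ∈ Finset.range M with ((j : ℕ) + 1 / 2 : ℝ) * π / (1 - ω) < R,
      coshPoleTerm ω k j
    refine (norm_sub_le_norm_sub_add_norm_sub _ ((2 * π ^ 2 * (A' + B') : ℝ) : ℂ) _).trans ?_
    rw [← ofReal_sub, norm_real, Real.norm_eq_abs, ← mul_sub, abs_mul,
      abs_of_pos (by positivity : 0 < 2 * π ^ 2), Finset.sum_add_distrib]
    have hsplit : |A' + B' - (∑ i ∈ Finset.range M, sinhPoleTerm ω k i +
        ∑ i ∈ Finset.range M, coshPoleTerm ω k i)| ≤ 2 * (C ^ 2 / m ^ 2 * (T ^ 2 * η)) := by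
      rw [abs_sub_comm, add_sub_add_comm]
      exact (abs_add_le _ _).trans (by linarith)
    have hfinal := hN₁ T hN₁T
    calc _ ≤ |K| * (1 + C) * (T ^ 2 * η) + 2 * π ^ 2 * (2 * (C ^ 2 / m ^ 2 * (T ^ 2 * η))) := by
          gcongr
          exact hmain.trans htail
      _ = H * (T ^ 2 * η) := by rw [hH]; ring
      _ ≤ ε := hfinal

lemma phi0FTterm_succPNat (ω k : ℝ) (n : ℕ) :
    phi0FTterm ω k n.succPNat = sinhPoleTerm ω k n + coshPoleTerm ω k n := by
  have h1 : (((n.succPNat : ℕ+) : ℕ) : ℝ) = n + 1 := by simp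
  have h2 : ((n.succPNat : ℕ+) : ℕ) - 1 = n := by simp
  have h3 : (n : ℝ) + 1 - 1 / 2 = n + 1 / 2 := by ring
  have h4 (x c d : ℝ) : -x * π * k / c = -(x * π / c * k) ∧ x * π * d / c = d * (x * π / c) :=
    ⟨by ring, by ring⟩
  rw [phi0FTterm, sinhPoleTerm, coshPoleTerm, h1, h2, h3, (h4 _ ω (1 - ω)).1, (h4 _ ω (1 - ω)).2,
    (h4 _ (1 - ω) ω).1, (h4 _ (1 - ω) ω).2, mul_add]

theorem phi0_fourier_series (ω : ℝ) (hω0 : 0 < ω) (hω1 : ω < 1)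
    (hcos : ∀ n : ℕ+, Real.cos ((n : ℝ) * π * (1 - ω) / ω) ≠ 0)
    (hsin : ∀ n : ℕ+, Real.sin (((n : ℝ) - 1 / 2) * π * ω / (1 - ω)) ≠ 0)
    (k : ℝ) (hk : 0 < k)
    (habs : Summable (fun n : ℕ+ => |phi0FTterm ω k n|)) :
    (∫ t : ℝ, (phi0 ω t : ℂ) * Complex.exp (Complex.I * k * t)) =
      ((2 * π ^ 2 * ∑' n : ℕ+, phi0FTterm ω k n : ℝ) : ℂ) := by
  have hcos' (n : ℕ) : Real.cos ((1 - ω) * ((n + 1) * π / ω)) ≠ 0 := by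
    convert hcos n.succPNat using 2
    rw [Nat.succPNat_coe, Nat.cast_succ]
    ring
  have hsin' (n : ℕ) : Real.sin (ω * ((n + 1 / 2) * π / (1 - ω))) ≠ 0 := by
    convert hsin n.succPNat using 2
    rw [Nat.succPNat_coe, Nat.cast_succ]
    ring
  have hsum : HasSum (fun n : ℕ => sinhPoleTerm ω k n + coshPoleTerm ω k n)
      (∑' n : ℕ+, phi0FTterm ω k n) := by
    simp_rw [← phi0FTterm_succPNat]
    exact (Equiv.pnatEquivNat.symm.hasSum_iff (f := phi0FTterm ω k)).2 habs.of_abs.hasSum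
  set J := ∫ t : ℝ, (phi0 ω t : ℂ) * cexp (I * k * t)
  have hlim : Tendsto (fun M => ‖J - ((2 * π ^ 2 * ∑ i ∈ Finset.range M,
      (sinhPoleTerm ω k i + coshPoleTerm ω k i) : ℝ) : ℂ)‖) atTop
      (𝓝 ‖J - ((2 * π ^ 2 * ∑' n : ℕ+, phi0FTterm ω k n : ℝ) : ℂ)‖) :=
    (tendsto_const_nhds.sub ((continuous_ofReal.tendsto _).comp
      (hsum.tendsto_sum_nat.const_mul _))).norm
  have hle : ‖J - ((2 * π ^ 2 * ∑' n : ℕ+, phi0FTterm ω k n : ℝ) : ℂ)‖ ≤ 0 :=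
    le_of_forall_pos_le_add fun ε hε => by
      rw [zero_add]
      refine le_of_tendsto_of_frequently hlim (frequently_atTop.2 fun N => ?_)
      exact exists_norm_integral_sub_sum_range_le hω0 hω1 hcos' hsin' hk hε N
  exact sub_eq_zero.1 (norm_le_zero_iff.1 hle)
end
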